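/- Every abelian group that has a Borel code and is a Whitehead group is ℵ₂-free. -/

import Mathlib

open MeasureTheory Cardinal

/-- Cantor space: `ℕ → Bool` with the product topology. Its product measurable-space
structure coincides with the Borel σ-algebra of the product topology. -/
abbrev Cantor : Type := ℕ → Bool

/-- A Borel code for an abelian group `B`: a Borel set `Bstar ⊆ Cantor`, a Borel set
`E ⊆ Cantor × Cantor` whose restriction to `Bstar × Bstar` is an equivalence relation,
and a surjection `q : Bstar → B` inducing the group structure, such that the graph of
addition is Borel. -/
structure BorelCode (B : Type*) [AddCommGroup B] where
  Bstar : Set Cantor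
  E : Set (Cantor × Cantor)
  q : Cantor → B
  borel_Bstar : MeasurableSet Bstar
  borel_E : MeasurableSet E
  refl : ∀ x ∈ Bstar, (x, x) ∈ E
  symm : ∀ x ∈ Bstar, ∀ y ∈ Bstar, (x, y) ∈ E → (y, x) ∈ E
  trans : ∀ x ∈ Bstar, ∀ y ∈ Bstar, ∀ z ∈ Bstar, (x, y) ∈ E → (y, z) ∈ E → (x, z) ∈ E
  surj : ∀ b : B, ∃ x ∈ Bstar, q x = b
  q_eq_iff : ∀ x ∈ Bstar, ∀ y ∈ Bstar, (q x = q y ↔ (x, y) ∈ E)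
  borel_add : MeasurableSet {p : Cantor × Cantor × Cantor |
    p.1 ∈ Bstar ∧ p.2.1 ∈ Bstar ∧ p.2.2 ∈ Bstar ∧ q p.1 + q p.2.1 = q p.2.2}

/-- An abelian group has a Borel code. -/
def HasBorelCode (B : Type*) [AddCommGroup B] : Prop := Nonempty (BorelCode B)

/-- An abelian group is ℵ₂-free if every subgroup of cardinality at most ℵ₁ is a free
abelian group. -/
def Aleph2Free (B : Type*) [AddCommGroup B] : Prop :=
  ∀ K : AddSubgroup B, Cardinal.mk K ≤ Cardinal.aleph 1 → Module.Free ℤ K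

/-- An abelian group `G` is a Whitehead group if for every abelian group `H` and every
surjective homomorphism `f : H → G` whose kernel is isomorphic to `ℤ`, `f` has a
right inverse which is a homomorphism (equivalently, `Ext¹(G, ℤ) = 0`). -/
def IsWhitehead (G : Type*) [AddCommGroup G] : Prop :=
  ∀ (H : Type*) [AddCommGroup H] (f : H →+ G), Function.Surjective f →
    Nonempty (f.ker ≃+ ℤ) → ∃ s : G →+ H, f.comp s = AddMonoidHom.id G

universe u

/-- Every homomorphism to `ℚ/ℤ` lifts to a homomorphism to `ℚ`; for an abelian group this is
equivalent to `Ext¹(A, ℤ) = 0`. -/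
def LiftsCharacters (A : Type*) [AddCommGroup A] : Prop :=
  ∀ φ : A →ₗ[ℤ] AddCircle (1 : ℚ), ∃ f : A →ₗ[ℤ] ℚ, ∀ a, (f a : AddCircle (1 : ℚ)) = φ a

/-- Every homomorphism to `ℤ` vanishes. -/
def HomIntTrivial (A : Type*) [AddCommGroup A] : Prop :=
  ∀ f : A →ₗ[ℤ] ℤ, f = 0

theorem exists_circle_extension {A B : Type*} [AddCommGroup A] [AddCommGroup B]
    (i : A →ₗ[ℤ] B) (hi : Function.Injective i) (φ : A →ₗ[ℤ] AddCircle (1 : ℚ)) :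
    ∃ ψ : B →ₗ[ℤ] AddCircle (1 : ℚ), ∀ a, ψ (i a) = φ a := by
  obtain ⟨h, hh⟩ := (Module.Baer.of_divisible (AddCircle (1 : ℚ))).extension_property i hi φ
  exact ⟨h, fun a => LinearMap.congr_fun hh a⟩

theorem exists_rat_extension {A B : Type*} [AddCommGroup A] [AddCommGroup B]
    (i : A →ₗ[ℤ] B) (hi : Function.Injective i) (φ : A →ₗ[ℤ] ℚ) :
    ∃ ψ : B →ₗ[ℤ] ℚ, ∀ a, ψ (i a) = φ a := by
  obtain ⟨h, hh⟩ := (Module.Baer.of_divisible ℚ).extension_property i hi φ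
  exact ⟨h, fun a => LinearMap.congr_fun hh a⟩

theorem coe_circle_eq_zero_iff (x : ℚ) : (x : AddCircle (1 : ℚ)) = 0 ↔ ∃ n : ℤ, (n : ℚ) = x := by
  rw [AddCircle.coe_eq_zero_iff]
  simp

theorem exists_int_factor {A : Type*} [AddCommGroup A] (f : A →ₗ[ℤ] ℚ)
    (hf : ∀ a, (f a : AddCircle (1 : ℚ)) = 0) : ∃ g : A →ₗ[ℤ] ℤ, ∀ a, (g a : ℚ) = f a := by
  choose g hg using fun a => (coe_circle_eq_zero_iff _).1 (hf a)
  refine ⟨(AddMonoidHom.mk' g fun a b => ?_).toIntLinearMap, hg⟩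
  have : ((g (a + b) : ℤ) : ℚ) = ((g a + g b : ℤ) : ℚ) := by
    push_cast; rw [hg, hg, hg, map_add]
  exact_mod_cast this

theorem HomIntTrivial.eq_zero_of_coe {A : Type*} [AddCommGroup A] (h : HomIntTrivial A)
    (f : A →ₗ[ℤ] ℚ) (hf : ∀ a, (f a : AddCircle (1 : ℚ)) = 0) (a : A) : f a = 0 := by
  obtain ⟨g, hg⟩ := exists_int_factor f hf
  rw [← hg a, h g]; simp

theorem HomIntTrivial.of_surjective {A B : Type*} [AddCommGroup A] [AddCommGroup B]
    (h : HomIntTrivial A) (p : A →ₗ[ℤ] B) (hp : Function.Surjective p) : HomIntTrivial B := by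
  intro f
  ext b
  obtain ⟨a, rfl⟩ := hp b
  exact LinearMap.congr_fun (h (f ∘ₗ p)) a

theorem LiftsCharacters.of_injective {A B : Type*} [AddCommGroup A] [AddCommGroup B]
    (h : LiftsCharacters B) (i : A →ₗ[ℤ] B) (hi : Function.Injective i) : LiftsCharacters A := by
  intro φ
  obtain ⟨ψ, hψ⟩ := exists_circle_extension i hi φ
  obtain ⟨f, hf⟩ := h ψ
  exact ⟨f ∘ₗ i, fun a => by simp [hf, hψ]⟩

theorem exists_linear_character {A : Type*} [AddCommGroup A] {a : A} (ha : a ≠ 0) :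
    ∃ φ : A →ₗ[ℤ] AddCircle (1 : ℚ), φ a ≠ 0 := by
  obtain ⟨c, hc⟩ := CharacterModule.exists_character_apply_ne_zero_of_ne_zero ha
  exact ⟨AddMonoidHom.toIntLinearMap c, hc⟩

theorem LiftsCharacters.eq_zero_of_smul {A : Type*} [AddCommGroup A] (h : LiftsCharacters A)
    {m : ℤ} (hm : m ≠ 0) {a : A} (ha : m • a = 0) : a = 0 := by
  by_contra hne
  obtain ⟨φ, hφ⟩ := exists_linear_character hne
  obtain ⟨f, hf⟩ := h φ
  have h1 : m • f a = 0 := by rw [← map_smul, ha, map_zero]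
  have h2 : f a = 0 := (smul_eq_zero.1 h1).resolve_left hm
  exact hφ (by rw [← hf, h2]; rfl)

theorem LiftsCharacters.exists_smul_eq {A : Type*} [AddCommGroup A] (h : LiftsCharacters A)
    (h0 : HomIntTrivial A) {p : ℤ} (hp : p ≠ 0) (a : A) : ∃ b : A, p • b = a := by
  by_contra! hne
  let N : Submodule ℤ A := LinearMap.range (p • (LinearMap.id : A →ₗ[ℤ] A))
  have hN : N.mkQ a ≠ 0 := by
    intro h1
    rw [Submodule.mkQ_apply, Submodule.Quotient.mk_eq_zero] at h1
    obtain ⟨b, hb⟩ := h1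
    exact hne b hb
  obtain ⟨χ, hχ⟩ := exists_linear_character hN
  obtain ⟨f, hf⟩ := h (χ ∘ₗ N.mkQ)
  have key : ∀ b, (p • f) b = 0 := by
    refine h0.eq_zero_of_coe (p • f) fun b => ?_
    have : (p • f) b = f (p • b) := by simp
    rw [this, hf]
    have h2 : N.mkQ (p • b) = 0 := by
      rw [Submodule.mkQ_apply, Submodule.Quotient.mk_eq_zero]
      exact ⟨b, rfl⟩
    simp only [LinearMap.comp_apply, h2, map_zero]
  have h3 : f a = 0 := (smul_eq_zero.1 (key a)).resolve_left hp
  exact hχ (by have := hf a; rw [h3] at this; exact this.symm)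

/-- A nonzero group all of whose characters lift to `ℚ` has a nonzero homomorphism to `ℤ`. -/
theorem LiftsCharacters.subsingleton {A : Type*} [AddCommGroup A] (h : LiftsCharacters A)
    (h0 : HomIntTrivial A) : Subsingleton A := by
  by_contra hns
  rw [not_subsingleton_iff_nontrivial] at hns
  obtain ⟨x, hx⟩ := exists_ne (0 : A)
  choose d hd using h.exists_smul_eq h0 (p := 2) (by norm_num)
  let y : ℕ → A := fun n => d^[n] x
  have hy : ∀ n, (2 : ℤ) • y (n + 1) = y n := fun n => by
    simp only [y, Function.iterate_succ_apply', hd]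
  have hyk : ∀ n k, (2 : ℤ) ^ k • y (n + k) = y n := by
    intro n k
    induction k with
    | zero => simp
    | succ k ih => rw [pow_succ, mul_smul, ← add_assoc, hy, ih]
  let M : Submodule ℤ A := Submodule.span ℤ (Set.range y)
  have hM : LiftsCharacters M := h.of_injective M.subtype M.injective_subtype
  have hmem : ∀ z ∈ M, ∃ n, ∃ c : ℤ, z = c • y n := by
    intro z hz
    induction hz using Submodule.span_induction with
    | mem z hz => obtain ⟨n, rfl⟩ := hz; exact ⟨n, 1, by simp⟩
    | zero => exact ⟨0, 0, by simp⟩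
    | add u v _ _ hu hv =>
      obtain ⟨n, c, rfl⟩ := hu
      obtain ⟨n', c', rfl⟩ := hv
      refine ⟨n + n', c * 2 ^ n' + c' * 2 ^ n, ?_⟩
      rw [add_smul, mul_smul, mul_smul, hyk]
      rw [add_comm n n', hyk]
    | smul c u _ hu =>
      obtain ⟨n, c', rfl⟩ := hu
      exact ⟨n, c * c', by rw [mul_smul]⟩
  have hy_mem : ∀ n, y n ∈ M := fun n => Submodule.subset_span ⟨n, rfl⟩
  have hM0 : HomIntTrivial M := by
    intro f
    ext ⟨z, hz⟩
    obtain ⟨n, c, rfl⟩ := hmem z hz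
    have h1 : ∀ k, (2 : ℤ) ^ k ∣ f ⟨y n, hy_mem n⟩ := fun k =>
      ⟨f ⟨y (n + k), hy_mem _⟩, by
        rw [← smul_eq_mul, ← map_smul]
        congr 1
        exact Subtype.ext (hyk n k).symm⟩
    have h2 : f ⟨y n, hy_mem n⟩ = 0 := by
      by_contra hne
      have h3 := Int.natAbs_dvd_natAbs.2 (h1 (f ⟨y n, hy_mem n⟩).natAbs)
      have h4 := Nat.le_of_dvd (Int.natAbs_pos.2 hne) h3
      rw [Int.natAbs_pow] at h4
      exact absurd h4 (not_le.2 Nat.lt_two_pow_self)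
    have h5 : (⟨c • y n, hz⟩ : M) = c • ⟨y n, hy_mem n⟩ := rfl
    rw [h5, map_smul, h2]; simp
  obtain ⟨⟨b, hb⟩, hb3⟩ := hM.exists_smul_eq hM0 (p := 3) (by norm_num) ⟨y 0, hy_mem 0⟩
  obtain ⟨n, c, rfl⟩ := hmem b hb
  have h6 : (3 : ℤ) • c • y n = (2 : ℤ) ^ n • y n := by
    have h7 := congrArg Subtype.val hb3
    have h8 := hyk 0 n
    rw [zero_add] at h8
    rw [h8]; exact h7
  have h9 : (3 * c - 2 ^ n) • y n = 0 := by rw [sub_smul, mul_smul, h6, sub_self]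
  have h10 : (3 * c - 2 ^ n : ℤ) ≠ 0 := by
    intro h11
    have h12 : (3 : ℤ) ∣ 2 ^ n := ⟨c, by linarith⟩
    have h13 := Int.prime_three.dvd_of_dvd_pow h12
    norm_num at h13
  have h14 := h.eq_zero_of_smul h10 h9
  have h15 := hyk 0 n
  rw [zero_add, h14, smul_zero] at h15
  exact hx h15.symm

theorem LiftsCharacters.exists_hom_ne_zero {A : Type*} [AddCommGroup A] (h : LiftsCharacters A)
    (D : Submodule ℤ A) (hD : HomIntTrivial D) : D = ⊥ := by
  have := (h.of_injective D.subtype D.injective_subtype).subsingleton hD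
  exact (Submodule.eq_bot_iff D).2 fun x hx => congrArg Subtype.val
    (Subsingleton.elim (⟨x, hx⟩ : D) 0)

theorem IsWhitehead.liftsCharacters {B : Type*} [AddCommGroup B] (hcode : HasBorelCode B)
    (hwh : IsWhitehead B) : LiftsCharacters B := by
  intro φ
  obtain ⟨code⟩ := hcode
  let H : Submodule ℤ (B × ℚ) := LinearMap.ker
    (φ ∘ₗ LinearMap.fst ℤ B ℚ -
      (QuotientAddGroup.mk' (AddSubgroup.zmultiples (1 : ℚ))).toIntLinearMap ∘ₗ
        LinearMap.snd ℤ B ℚ)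
  have hH : ∀ b t, (b, t) ∈ H ↔ (t : AddCircle (1 : ℚ)) = φ b := by
    intro b t
    rw [LinearMap.mem_ker]
    simp only [LinearMap.sub_apply, LinearMap.comp_apply, LinearMap.fst_apply,
      LinearMap.snd_apply, sub_eq_zero]
    exact eq_comm
  have : Small.{0} B := small_of_surjective (f := fun x : code.Bstar => code.q x) fun b => by
    obtain ⟨x, hx, rfl⟩ := code.surj b
    exact ⟨⟨x, hx⟩, rfl⟩
  have : Small.{0} H := small_subset (Set.subset_univ _)
  let e : ULift (Shrink.{0} H) ≃+ H := AddEquiv.ulift.trans (Shrink.addEquiv (α := H))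
  let f : ULift (Shrink.{0} H) →+ B :=
    ((LinearMap.fst ℤ B ℚ) ∘ₗ H.subtype).toAddMonoidHom.comp e.toAddMonoidHom
  have hf : ∀ x, f x = (e x).1.1 := fun x => rfl
  obtain ⟨s, hs⟩ := hwh (ULift (Shrink.{0} H)) f (by
      intro b
      obtain ⟨t, ht⟩ := QuotientAddGroup.mk_surjective (φ b)
      exact ⟨e.symm ⟨(b, t), (hH b t).2 ht⟩, by rw [hf]; simp⟩) (by
      refine ⟨(AddEquiv.ofBijective (AddMonoidHom.mk' (fun n : ℤ => (⟨e.symm ⟨(0, (n : ℚ)),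
        (hH _ _).2 ?_⟩, ?_⟩ : f.ker)) ?_) ⟨?_, ?_⟩).symm⟩
      · rw [map_zero, coe_circle_eq_zero_iff]; exact ⟨n, rfl⟩
      · rw [AddMonoidHom.mem_ker, hf]; simp
      · intro a b
        apply Subtype.ext
        show e.symm _ = e.symm _ + e.symm _
        rw [← map_add]
        congr 1
        apply Subtype.ext
        simp
      · intro a b hab
        have h1 := congrArg Subtype.val hab
        have h2 := e.symm.injective h1
        simpa using h2
      · rintro ⟨x, hx⟩
        rw [AddMonoidHom.mem_ker, hf] at hx
        have h1 : ((e x).1.2 : AddCircle (1 : ℚ)) = φ (e x).1.1 := (hH _ _).1 (e x).2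
        rw [hx, map_zero, coe_circle_eq_zero_iff] at h1
        obtain ⟨n, hn⟩ := h1
        refine ⟨n, Subtype.ext ?_⟩
        show e.symm _ = x
        rw [AddEquiv.symm_apply_eq]
        exact Subtype.ext (Prod.ext hx.symm hn))
  let g : B →ₗ[ℤ] ℚ := (LinearMap.snd ℤ B ℚ) ∘ₗ H.subtype ∘ₗ
    (e.toAddMonoidHom.comp s).toIntLinearMap
  refine ⟨g, fun b => ?_⟩
  have h1 : ((e (s b)).1.2 : AddCircle (1 : ℚ)) = φ (e (s b)).1.1 := (hH _ _).1 (e (s b)).2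
  have h2 : (e (s b)).1.1 = b := by
    rw [← hf]; exact DFunLike.congr_fun hs b
  rw [h2] at h1
  exact h1

/-- The divisibility conditions `m i ∣ ∑ j, a i j * ζ j` have only the zero solution. -/
def IsRigid {n : ℕ} (m : ℕ → ℤ) (a : ℕ → Fin n → ℤ) : Prop :=
  (∀ i, m i ≠ 0) ∧ ∀ ζ : Fin n → ℤ, (∀ i, m i ∣ ∑ j, a i j * ζ j) → ζ = 0

/-- `m` divides `∑ j, a j • x j + k`. -/
def DivRel {B : Type*} [AddCommGroup B] {n : ℕ} (m : ℤ) (a : Fin n → ℤ) (k : B)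
    (x : Fin n → B) : Prop :=
  ∃ y, m • y = ∑ j, a j • x j + k

theorem IsRigid.homIntTrivial {A : Type*} [AddCommGroup A] {n : ℕ} {m : ℕ → ℤ}
    {a : ℕ → Fin n → ℤ} (h : IsRigid m a) (x : Fin n → A) (y : ℕ → A)
    (hxy : ∀ i, m i • y i = ∑ j, a i j • x j) :
    HomIntTrivial (Submodule.span ℤ (Set.range x ∪ Set.range y)) := by
  intro f
  have hx : ∀ j, x j ∈ Submodule.span ℤ (Set.range x ∪ Set.range y) := fun j =>
    Submodule.subset_span (Or.inl ⟨j, rfl⟩)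
  have hy : ∀ j, y j ∈ Submodule.span ℤ (Set.range x ∪ Set.range y) := fun j =>
    Submodule.subset_span (Or.inr ⟨j, rfl⟩)
  have h1 : ∀ i, m i * f ⟨y i, hy i⟩ = ∑ j, a i j * f ⟨x j, hx j⟩ := by
    intro i
    have : m i • (⟨y i, hy i⟩ : Submodule.span ℤ (Set.range x ∪ Set.range y)) =
        ∑ j, a i j • ⟨x j, hx j⟩ := by
      apply Subtype.ext
      simpa using hxy i
    have h2 := congrArg f this
    simpa only [map_sum, map_smul, smul_eq_mul] using h2
  have hζ := h.2 (fun j => f ⟨x j, hx j⟩) fun i => ⟨_, (h1 i).symm⟩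
  have hfx : ∀ j, f ⟨x j, hx j⟩ = 0 := fun j => congrFun hζ j
  have hfy : ∀ i, f ⟨y i, hy i⟩ = 0 := fun i => by
    have h3 := h1 i
    simp only [hfx, mul_zero, Finset.sum_const_zero] at h3
    exact (mul_eq_zero.1 h3).resolve_left (h.1 i)
  ext ⟨z, hz⟩
  show f ⟨z, hz⟩ = 0
  induction hz using Submodule.span_induction with
  | mem z hz =>
    rcases hz with ⟨j, rfl⟩ | ⟨i, rfl⟩
    · exact hfx j
    · exact hfy i
  | zero => exact map_zero f
  | add u v hu hv h1 h2 =>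
    have : f (⟨u, hu⟩ + ⟨v, hv⟩) = 0 := by rw [map_add, h1, h2, add_zero]
    exact this
  | smul c u hu h1 =>
    have : f (c • ⟨u, hu⟩) = 0 := by rw [map_smul, h1, smul_zero]
    exact this

theorem LiftsCharacters.divRel_unique {B : Type*} [AddCommGroup B] (hB : LiftsCharacters B)
    {n : ℕ} {m : ℕ → ℤ} {a : ℕ → Fin n → ℤ} (h : IsRigid m a) {k : ℕ → B} {x x' : Fin n → B}
    (hx : ∀ i, DivRel (m i) (a i) (k i) x) (hx' : ∀ i, DivRel (m i) (a i) (k i) x') :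
    x = x' := by
  choose y hy using hx
  choose y' hy' using hx'
  have h1 := h.homIntTrivial (x - x') (y - y') fun i => by
    simp only [Pi.sub_apply, smul_sub, hy, hy', Finset.sum_sub_distrib]
    abel
  have h2 := hB.exists_hom_ne_zero _ h1
  funext j
  have h3 : (x - x') j ∈ Submodule.span ℤ (Set.range (x - x') ∪ Set.range (y - y')) :=
    Submodule.subset_span (Or.inl ⟨j, rfl⟩)
  rw [h2, Submodule.mem_bot] at h3
  exact sub_eq_zero.1 h3

theorem mk_iSup_lt_continuum {A ι : Type u} [AddCommGroup A] (D : ι → Submodule ℤ A)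
    (hD : ∀ i, Countable (D i)) (hι : #ι < 𝔠) : #(⨆ i, D i : Submodule ℤ A) < 𝔠 := by
  choose d hd using fun i => exists_surjective_nat (D i)
  let v : ι × ℕ → A := fun p => d p.1 p.2
  have h1 : (⨆ i, D i) ≤ Submodule.span ℤ (Set.range v) := by
    refine iSup_le fun i x hx => ?_
    obtain ⟨k, hk⟩ := hd i ⟨x, hx⟩
    exact Submodule.subset_span ⟨(i, k), by simp only [v, hk]⟩
  have h2 : (⨆ i, D i : Submodule ℤ A) ≤ LinearMap.range (Finsupp.linearCombination ℤ v) := by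
    rwa [Finsupp.range_linearCombination]
  have h3 : #(⨆ i, D i : Submodule ℤ A) ≤ #(ι × ℕ →₀ ℤ) :=
    (Cardinal.mk_le_mk_of_subset h2).trans
      (Cardinal.mk_le_of_surjective (Finsupp.linearCombination ℤ v).surjective_rangeRestrict)
  refine h3.trans_lt ?_
  rcases isEmpty_or_nonempty (ι × ℕ) with he | hne
  · refine lt_of_le_of_lt ?_ Cardinal.aleph0_lt_continuum
    exact Cardinal.mk_le_aleph0
  · rw [Cardinal.mk_finsupp_lift_of_infinite']
    simp only [Cardinal.mk_prod, Cardinal.mk_denumerable, Cardinal.lift_aleph0,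
      Cardinal.lift_uzero]
    refine max_lt ?_ Cardinal.aleph0_lt_continuum
    exact Cardinal.mul_lt_of_lt Cardinal.aleph0_le_continuum hι Cardinal.aleph0_lt_continuum

theorem mk_linearMap_rat_le {K : Type u} [AddCommGroup K] [Countable K] :
    #(K →ₗ[ℤ] ℚ) ≤ 𝔠 := by
  have h1 : #(K →ₗ[ℤ] ℚ) ≤ #(K → ℚ) := Cardinal.mk_le_of_injective DFunLike.coe_injective
  refine h1.trans ?_
  rw [Cardinal.mk_pi]
  simp only [Cardinal.prod_const, Cardinal.mk_denumerable, Cardinal.lift_aleph0,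
    Cardinal.lift_uzero]
  calc (ℵ₀ : Cardinal) ^ #K ≤ ℵ₀ ^ ℵ₀ :=
        Cardinal.power_le_power_left Cardinal.aleph0_ne_zero Cardinal.mk_le_aleph0
    _ = 𝔠 := by simp

/-- The partial character `ψ` on `B ⧸ K` has no lift to `B` extending `c` on `K`. -/
def Kills {B : Type*} [AddCommGroup B] {K : Submodule ℤ B} (c : K →ₗ[ℤ] ℚ)
    (ψ : (B ⧸ K) →ₗ.[ℤ] AddCircle (1 : ℚ)) : Prop :=
  ∀ f : B →ₗ[ℤ] ℚ, (∀ k : K, f k = c k) →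
    ¬ ∀ (b : B) (hb : K.mkQ b ∈ ψ.domain), (f b : AddCircle (1 : ℚ)) = ψ ⟨K.mkQ b, hb⟩

theorem Kills.mono {B : Type*} [AddCommGroup B] {K : Submodule ℤ B} {c : K →ₗ[ℤ] ℚ}
    {ψ ψ' : (B ⧸ K) →ₗ.[ℤ] AddCircle (1 : ℚ)} (h : Kills c ψ) (hle : ψ ≤ ψ') : Kills c ψ' := by
  intro f hf hb
  refine h f hf fun b hbd => ?_
  rw [hb b (hle.1 hbd)]
  exact (hle.2 rfl).symm

/-- One extension step: among two extensions of `ψ` to `L ⊔ D`, one kills `c`. -/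
theorem exists_kills {B : Type*} [AddCommGroup B]
    {K : Submodule ℤ B} (c : K →ₗ[ℤ] ℚ) {L D L' : Submodule ℤ (B ⧸ K)}
    (hL : ∀ g : (B ⧸ K) →ₗ[ℤ] ℚ, (∀ a ∈ L, (g a : AddCircle (1 : ℚ)) = 0) → ∀ a ∈ L, g a = 0)
    (hD : HomIntTrivial D) (hDL : ¬ D ≤ L) (hLL' : L ≤ L') (hDL' : D ≤ L')
    (ψ : (B ⧸ K) →ₗ.[ℤ] AddCircle (1 : ℚ)) (hψ : ψ.domain = L) :
    ∃ ψ' : (B ⧸ K) →ₗ.[ℤ] AddCircle (1 : ℚ), ψ ≤ ψ' ∧ ψ'.domain = L' ∧ Kills c ψ' := by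
  subst hψ
  set L := ψ.domain
  obtain ⟨ψt, hψt⟩ := exists_circle_extension L.subtype L.injective_subtype ψ.toFun
  let C : Submodule ℤ ((B ⧸ K) ⧸ L) := D.map L.mkQ
  have hC : HomIntTrivial C := by
    refine hD.of_surjective (L.mkQ.submoduleMap D) (L.mkQ.submoduleMap_surjective D)
  have hC1 : ¬ LiftsCharacters C := by
    intro hlift
    have h1 := hlift.subsingleton hC
    apply hDL
    intro d hd
    have h2 : (⟨L.mkQ d, Submodule.mem_map_of_mem hd⟩ : C) = 0 := Subsingleton.elim _ _
    have h3 : L.mkQ d = 0 := congrArg Subtype.val h2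
    rwa [Submodule.mkQ_apply, Submodule.Quotient.mk_eq_zero] at h3
  unfold LiftsCharacters at hC1
  push Not at hC1
  obtain ⟨θ0, hθ0⟩ := hC1
  obtain ⟨θ, hθ⟩ := exists_circle_extension C.subtype C.injective_subtype θ0
  let ψ1 : (B ⧸ K) →ₗ.[ℤ] AddCircle (1 : ℚ) := ⟨L', ψt ∘ₗ L'.subtype⟩
  let ψ2 : (B ⧸ K) →ₗ.[ℤ] AddCircle (1 : ℚ) := ⟨L', (ψt + θ ∘ₗ L.mkQ) ∘ₗ L'.subtype⟩
  have hle1 : ψ ≤ ψ1 := by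
    refine ⟨hLL', ?_⟩
    rintro ⟨x, hx⟩ ⟨y, hy⟩ (rfl : x = y)
    exact (hψt ⟨x, hx⟩).symm
  have hle2 : ψ ≤ ψ2 := by
    refine ⟨hLL', ?_⟩
    rintro ⟨x, hx⟩ ⟨y, hy⟩ (rfl : x = y)
    have h1 : L.mkQ x = 0 := by rwa [Submodule.mkQ_apply, Submodule.Quotient.mk_eq_zero]
    show ψ.toFun ⟨x, hx⟩ = ψt x + θ (L.mkQ x)
    rw [h1, map_zero, add_zero]
    exact (hψt ⟨x, hx⟩).symm
  by_contra! hcon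
  have hn1 := hcon ψ1 hle1 rfl
  have hn2 := hcon ψ2 hle2 rfl
  unfold Kills at hn1 hn2
  push Not at hn1 hn2
  obtain ⟨f1, hf1, hb1⟩ := hn1
  obtain ⟨f2, hf2, hb2⟩ := hn2
  let g : (B ⧸ K) →ₗ[ℤ] ℚ := K.liftQ (f2 - f1) fun k hk => by
    rw [LinearMap.mem_ker, LinearMap.sub_apply, hf1 ⟨k, hk⟩, hf2 ⟨k, hk⟩, sub_self]
  have hg : ∀ a ∈ L', (g a : AddCircle (1 : ℚ)) = θ (L.mkQ a) := by
    intro a ha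
    obtain ⟨b, rfl⟩ := K.mkQ_surjective a
    have e1 : (f1 b : AddCircle (1 : ℚ)) = ψt (K.mkQ b) := hb1 b ha
    have e2 : (f2 b : AddCircle (1 : ℚ)) = ψt (K.mkQ b) + θ (L.mkQ (K.mkQ b)) := hb2 b ha
    have e3 : g (K.mkQ b) = f2 b - f1 b := rfl
    rw [e3, AddCircle.coe_sub, e1, e2, add_sub_cancel_left]
  have hgL : ∀ a ∈ L, g a = 0 := hL g fun a ha => by
    rw [hg a (hLL' ha)]
    have h1 : L.mkQ a = 0 := by rwa [Submodule.mkQ_apply, Submodule.Quotient.mk_eq_zero]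
    rw [h1, map_zero]
  obtain ⟨⟨_, d, hd, rfl⟩, hne⟩ := hθ0 (L.liftQ g (fun a ha => hgL a ha) ∘ₗ C.subtype)
  have h4 := hg d (hDL' hd)
  apply hne
  rw [← hθ]
  exact h4

theorem LiftsCharacters.not_surjective_of_wellOrdered {B : Type*} [AddCommGroup B]
    (hB : LiftsCharacters B) {K : Submodule ℤ B} {X : Type*} [LinearOrder X] [WellFoundedLT X]
    (D : X → Submodule ℤ (B ⧸ K)) (hD : ∀ x, HomIntTrivial (D x))
    (hnew : ∀ x, ¬ D x ≤ ⨆ y ∈ Set.Iio x, D y) (c : X → K →ₗ[ℤ] ℚ) :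
    ¬ Function.Surjective c := by
  intro hc
  let S : Set ((B ⧸ K) →ₗ.[ℤ] AddCircle (1 : ℚ)) :=
    {ψ | ∃ J : Set X, IsLowerSet J ∧ ψ.domain = (⨆ y ∈ J, D y) ∧ ∀ x ∈ J, Kills (c x) ψ}
  have hvanish : ∀ (J : Set X) (g : (B ⧸ K) →ₗ[ℤ] ℚ),
      (∀ a ∈ (⨆ y ∈ J, D y), (g a : AddCircle (1 : ℚ)) = 0) → ∀ a ∈ (⨆ y ∈ J, D y), g a = 0 := by
    intro J g hg
    have h1 : (⨆ y ∈ J, D y) ≤ LinearMap.ker g := by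
      refine iSup₂_le fun y hy a ha => ?_
      exact (hD y).eq_zero_of_coe (g ∘ₗ (D y).subtype)
        (fun b => hg b ((le_iSup₂_of_le (f := fun y (_ : y ∈ J) => D y) y hy le_rfl) b.2)) ⟨a, ha⟩
    exact fun a ha => h1 ha
  obtain ⟨ψ, hψS, hmax⟩ := zorn_le₀ S (by
    intro C hCS hC
    have hCS' : ∀ ψ ∈ C, ∃ J : Set X, IsLowerSet J ∧ ψ.domain = (⨆ y ∈ J, D y) ∧
      ∀ x ∈ J, Kills (c x) ψ := fun ψ hψ => hCS hψ
    choose! J hJ hdom hkill using hCS'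
    have hdir : DirectedOn (· ≤ ·) C := hC.directedOn
    refine ⟨LinearPMap.sSup C hdir, ⟨⋃ ψ ∈ C, J ψ, ?_, ?_, ?_⟩, fun ψ hψ =>
      LinearPMap.le_sSup hdir hψ⟩
    · exact isLowerSet_iUnion₂ fun ψ hψ => hJ ψ hψ
    · rw [LinearPMap.domain_sSup, sSup_image, iSup_iUnion]
      refine iSup_congr fun ψ => ?_
      rw [iSup_iUnion]
      exact iSup_congr fun hψ => hdom ψ hψ
    · intro x hx
      simp only [Set.mem_iUnion] at hx
      obtain ⟨ψ, hψ, hx⟩ := hx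
      exact (hkill ψ hψ x hx).mono (LinearPMap.le_sSup hdir hψ))
  obtain ⟨J, hJ, hdom, hkill⟩ := hψS
  have hJuniv : J = Set.univ := by
    by_contra hne
    obtain ⟨x, hxJ, hxmin⟩ := WellFounded.has_min (wellFounded_lt (α := X)) Jᶜ
      (Set.nonempty_compl.2 hne)
    have hJx : J = Set.Iio x := by
      ext y
      constructor
      · intro hy
        exact not_le.1 fun hxy => hxJ (hJ hxy hy)
      · intro hy
        by_contra hyJ
        exact hxmin y hyJ hy
    subst hJx
    obtain ⟨ψ', hle, hdom', hk'⟩ := exists_kills (c x) (L' := ⨆ y ∈ Set.Iic x, D y)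
      (hvanish (Set.Iio x)) (hD x)
      (hnew x) (biSup_mono fun y hy => le_of_lt hy)
      (le_iSup₂_of_le (f := fun y (_ : y ∈ Set.Iic x) => D y) x le_rfl le_rfl) ψ hdom
    have h1 : ψ' ≤ ψ := hmax ⟨Set.Iic x, isLowerSet_Iic x, hdom', fun y hy => by
      rcases eq_or_lt_of_le (show y ≤ x from hy) with rfl | hlt
      · exact hk'
      · exact (hkill y hlt).mono hle⟩ hle
    apply hnew x
    have h2 := h1.1
    rw [hdom', hdom] at h2
    exact (le_iSup₂_of_le (f := fun y (_ : y ∈ Set.Iic x) => D y) x le_rfl le_rfl).trans h2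
  obtain ⟨ψt, hψt⟩ := exists_circle_extension ψ.domain.subtype ψ.domain.injective_subtype ψ.toFun
  obtain ⟨f, hf⟩ := hB (ψt ∘ₗ K.mkQ)
  obtain ⟨x, hx⟩ := hc (f ∘ₗ K.subtype)
  refine hkill x (hJuniv ▸ Set.mem_univ x) f (fun k => by rw [hx]; rfl) fun b hb => ?_
  rw [hf b]
  exact hψt ⟨_, hb⟩

/-- The diagonal theorem: countable subgroups of `B ⧸ K` without homomorphisms to `ℤ` span a
subgroup of size less than the continuum. -/
theorem LiftsCharacters.mk_iSup_lt_continuum {B ι : Type u} [AddCommGroup B]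
    (hB : LiftsCharacters B) (K : Submodule ℤ B) [Countable K]
    (D : ι → Submodule ℤ (B ⧸ K)) (hc : ∀ i, Countable (D i))
    (h0 : ∀ i, HomIntTrivial (D i)) : #(⨆ i, D i : Submodule ℤ (B ⧸ K)) < 𝔠 := by
  obtain ⟨_, _⟩ := exists_wellFoundedLT (α := ι)
  let X0 : Set ι := {x | ¬ D x ≤ ⨆ y ∈ Set.Iio x, D y}
  have hsup : ∀ x : ι, D x ≤ ⨆ y ∈ X0 ∩ Set.Iic x, D y := by
    intro x
    induction x using WellFoundedLT.induction with
    | _ x ih =>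
    by_cases hx : x ∈ X0
    · exact le_iSup₂_of_le (f := fun y (_ : y ∈ X0 ∩ Set.Iic x) => D y) x
        ⟨hx, le_rfl⟩ le_rfl
    · refine (not_not.1 hx).trans (iSup₂_le fun y hy => (ih y hy).trans ?_)
      exact biSup_mono fun z hz => ⟨hz.1, hz.2.trans (le_of_lt hy)⟩
  have hle : (⨆ i, D i) ≤ ⨆ x : X0, D x.1 := by
    refine iSup_le fun i => (hsup i).trans ?_
    refine iSup₂_le fun y hy => le_iSup (fun x : X0 => D x.1) ⟨y, hy.1⟩
  refine (Cardinal.mk_le_mk_of_subset hle).trans_lt ?_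
  refine _root_.mk_iSup_lt_continuum _ (fun x => hc x.1) ?_
  by_contra! hge
  obtain ⟨j⟩ : #(K →ₗ[ℤ] ℚ) ≤ #X0 := mk_linearMap_rat_le.trans hge
  refine hB.not_surjective_of_wellOrdered (X := X0) (fun x => D x.1) (fun x => h0 x.1) ?_
    (Function.invFun j) (Function.invFun_surjective j.injective)
  intro x hx
  refine x.2 (hx.trans (iSup₂_le fun y hy => ?_))
  exact le_iSup₂_of_le (f := fun (z : ι) (_ : z ∈ Set.Iio x.1) => D z) y.1 hy le_rfl

/-- A dense open subset of a product has dense vertical sections over a dense set of points. -/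
theorem dense_setOf_dense_sections {X : Type*} [TopologicalSpace X] [BaireSpace X]
    [SecondCountableTopology X] (W : ℕ → Set (X × X)) (hWo : ∀ j, IsOpen (W j))
    (hWd : ∀ j, Dense (W j)) : Dense {t | ∀ j, Dense {t' | (t, t') ∈ W j}} := by
  let b := TopologicalSpace.countableBasis X
  have hb := TopologicalSpace.isBasis_countableBasis X
  have hbc : b.Countable := TopologicalSpace.countable_countableBasis X
  have : Countable b := hbc.to_subtype
  have h1 : Dense (⋂ p : ℕ × b, {t | ∃ t' ∈ p.2.1, (t, t') ∈ W p.1}) := by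
    refine dense_iInter_of_isOpen (fun p => ?_) fun p => ?_
    · have : {t | ∃ t' ∈ p.2.1, (t, t') ∈ W p.1} = Prod.fst '' (W p.1 ∩ Set.univ ×ˢ p.2.1) := by
        ext t
        simp only [Set.mem_ofPred_eq, Set.mem_image, Set.mem_inter_iff, Set.mem_prod,
          Set.mem_univ, true_and, Prod.exists]
        constructor
        · rintro ⟨t', h1, h2⟩; exact ⟨t, t', ⟨h2, h1⟩, rfl⟩
        · rintro ⟨_, t', ⟨h2, h1⟩, rfl⟩; exact ⟨t', h1, h2⟩
      rw [this]
      exact isOpenMap_fst _ ((hWo _).inter (isOpen_univ.prod (hb.isOpen p.2.2)))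
    · refine dense_iff_inter_open.2 fun U hU hUn => ?_
      have hne : p.2.1.Nonempty := TopologicalSpace.nonempty_of_mem_countableBasis p.2.2
      obtain ⟨⟨t, t'⟩, ⟨ht, ht'⟩, hw⟩ := (hWd p.1).inter_open_nonempty (U ×ˢ p.2.1)
        (hU.prod (hb.isOpen p.2.2)) (hUn.prod hne)
      exact ⟨t, ht, t', ht', hw⟩
  refine h1.mono fun t ht j => ?_
  rw [Set.mem_iInter] at ht
  refine hb.dense_iff.2 fun o ho _ => ?_
  obtain ⟨t', h1, h2⟩ := ht (j, ⟨o, ho⟩)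
  exact ⟨t', h1, h2⟩

theorem exists_dense_open_seq {X : Type*} [TopologicalSpace X] {s : Set X}
    (hs : s ∈ residual X) :
    ∃ W : ℕ → Set X, (∀ j, IsOpen (W j)) ∧ (∀ j, Dense (W j)) ∧ ⋂ j, W j ⊆ s := by
  obtain ⟨S, hSo, hSd, hSc, hS⟩ := mem_residual_iff.1 hs
  obtain ⟨W, hW⟩ := (hSc.insert Set.univ).exists_eq_range (Set.insert_nonempty _ _)
  have hmem : ∀ j, W j = Set.univ ∨ W j ∈ S := fun j =>
    (hW.symm ▸ Set.mem_range_self j : W j ∈ insert Set.univ S)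
  refine ⟨W, fun j => ?_, fun j => ?_, fun x hx => hS fun t ht => ?_⟩
  · rcases hmem j with h | h
    · rw [h]; exact isOpen_univ
    · exact hSo _ h
  · rcases hmem j with h | h
    · rw [h]; exact dense_univ
    · exact hSd _ h
  · have : t ∈ Set.range W := hW ▸ Set.mem_insert_of_mem _ ht
    obtain ⟨j, rfl⟩ := this
    exact Set.mem_iInter.1 hx j

/-- A Borel set in the plane with nowhere dense vertical sections is meagre. -/
theorem compl_mem_residual_of_sections {X : Type*} [TopologicalSpace X] [BaireSpace X]
    [SecondCountableTopology X] [MeasurableSpace X] [BorelSpace X] {R : Set (X × X)}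
    (hR : MeasurableSet R) (hsec : ∀ t, IsNowhereDense {t' | (t, t') ∈ R}) :
    Rᶜ ∈ residual (X × X) := by
  obtain ⟨O, hO, hRO⟩ := hR.residualEq_isOpen
  have hdiff : {p | p ∈ R ↔ p ∈ O} ∈ residual (X × X) :=
    hRO.mono fun p hp => iff_of_eq hp
  obtain ⟨W, hWo, hWd, hW⟩ := exists_dense_open_seq hdiff
  rcases O.eq_empty_or_nonempty with rfl | ⟨⟨t, t'⟩, ht⟩
  · filter_upwards [hdiff] with p hp hpR
    exact hp.1 hpR
  · exfalso
    obtain ⟨U, V, hU, hV, htU, htV, hUV⟩ := isOpen_prod_iff.1 hO t t' ht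
    obtain ⟨u, huU, hu⟩ := (dense_setOf_dense_sections W hWo hWd).inter_open_nonempty U hU ⟨t, htU⟩
    have hdense : Dense (⋂ j, {t' | (u, t') ∈ W j}) := by
      refine dense_iInter_of_isOpen (fun j => ?_) hu
      exact (hWo j).preimage (Continuous.prodMk_right u)
    have hsub : V ⊆ closure {t' | (u, t') ∈ R} := by
      refine (hdense.open_subset_closure_inter hV).trans (closure_mono ?_)
      rintro v ⟨hvV, hv⟩
      have h1 : (u, v) ∈ ⋂ j, W j := Set.mem_iInter.2 fun j => Set.mem_iInter.1 hv j
      exact (hW h1).2 (hUV ⟨huU, hvV⟩)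
    have h2 := interior_maximal hsub hV htV
    have h3 : interior (closure {t' | (u, t') ∈ R}) = ∅ := hsec u
    rw [h3] at h2
    exact h2

theorem exists_refinement {X ι : Type*} [TopologicalSpace X] {O : Set (X × X)}
    (hO : IsOpen O) (hOd : Dense O) (P : Finset (ι × ι)) (V : ι → Set X)
    (hV : ∀ i, IsOpen (V i)) (hVn : ∀ i, (V i).Nonempty) :
    ∃ V' : ι → Set X, (∀ i, IsOpen (V' i)) ∧ (∀ i, (V' i).Nonempty) ∧ (∀ i, V' i ⊆ V i) ∧
      ∀ p ∈ P, p.1 ≠ p.2 → V' p.1 ×ˢ V' p.2 ⊆ O := by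
  classical
  induction P using Finset.induction_on with
  | empty => exact ⟨V, hV, hVn, fun _ => subset_rfl, by simp⟩
  | insert p P _ ih =>
    obtain ⟨V1, hV1, hV1n, hV1V, hP⟩ := ih
    obtain ⟨i, j⟩ := p
    by_cases hij : i = j
    · refine ⟨V1, hV1, hV1n, hV1V, fun p hp hne => ?_⟩
      rcases Finset.mem_insert.1 hp with rfl | hp
      · exact absurd hij hne
      · exact hP p hp hne
    · obtain ⟨⟨x, y⟩, hxy, hxyO⟩ := hOd.inter_open_nonempty (V1 i ×ˢ V1 j)
        ((hV1 i).prod (hV1 j)) ((hV1n i).prod (hV1n j))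
      obtain ⟨A, C, hA, hC, hxA, hyC, hAC⟩ := isOpen_prod_iff.1 hO x y hxyO
      let V2 : ι → Set X := Function.update (Function.update V1 i (V1 i ∩ A)) j (V1 j ∩ C)
      have h2i : V2 i = V1 i ∩ A := by simp [V2, Function.update_of_ne hij]
      have h2j : V2 j = V1 j ∩ C := by simp [V2]
      have h2k : ∀ k, k ≠ i → k ≠ j → V2 k = V1 k := fun k hi hj => by
        simp [V2, Function.update_of_ne hi, Function.update_of_ne hj]
      have hsub : ∀ k, V2 k ⊆ V1 k := by
        intro k
        by_cases hk : k = j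
        · subst hk; rw [h2j]; exact Set.inter_subset_left
        · by_cases hk' : k = i
          · subst hk'; rw [h2i]; exact Set.inter_subset_left
          · rw [h2k k hk' hk]
      refine ⟨V2, fun k => ?_, fun k => ?_, fun k => (hsub k).trans (hV1V k), fun p hp hne => ?_⟩
      · by_cases hk : k = j
        · subst hk; rw [h2j]; exact (hV1 _).inter hC
        · by_cases hk' : k = i
          · subst hk'; rw [h2i]; exact (hV1 _).inter hA
          · rw [h2k k hk' hk]; exact hV1 k
      · by_cases hk : k = j
        · subst hk; rw [h2j]; exact ⟨y, hxy.2, hyC⟩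
        · by_cases hk' : k = i
          · subst hk'; rw [h2i]; exact ⟨x, hxy.1, hxA⟩
          · rw [h2k k hk' hk]; exact hV1n k
      · rcases Finset.mem_insert.1 hp with rfl | hp
        · rw [h2i, h2j]
          exact (Set.prod_mono Set.inter_subset_right Set.inter_subset_right).trans hAC
        · exact (Set.prod_mono (hsub _) (hsub _)).trans (hP p hp hne)

theorem exists_ball_refinement {X ι : Type*} [MetricSpace X] [Finite ι] {O : Set (X × X)}
    (hO : IsOpen O) (hOd : Dense O) (n : ℕ) (V : ι → X × ℝ) (hV : ∀ i, 0 < (V i).2) :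
    ∃ V' : ι → X × ℝ, (∀ i, 0 < (V' i).2) ∧ (∀ i, (V' i).2 ≤ (1 / 2) ^ n) ∧
      (∀ i, Metric.closedBall (V' i).1 (V' i).2 ⊆ Metric.ball (V i).1 (V i).2) ∧
      ∀ i j, i ≠ j →
        Metric.closedBall (V' i).1 (V' i).2 ×ˢ Metric.closedBall (V' j).1 (V' j).2 ⊆ O := by
  have := Fintype.ofFinite ι
  obtain ⟨U, hUo, hUn, hUV, hU⟩ := exists_refinement hO hOd Finset.univ
    (fun i => Metric.ball (V i).1 (V i).2) (fun i => Metric.isOpen_ball)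
    (fun i => ⟨_, Metric.mem_ball_self (hV i)⟩)
  choose x hx using hUn
  choose ε hε hεU using fun i => Metric.nhds_basis_closedBall.mem_iff.1 ((hUo i).mem_nhds (hx i))
  have hsub : ∀ i, Metric.closedBall (x i) (min (ε i) ((1 / 2) ^ n)) ⊆ U i := fun i =>
    (Metric.closedBall_subset_closedBall (min_le_left _ _)).trans (hεU i)
  refine ⟨fun i => (x i, min (ε i) ((1 / 2) ^ n)), fun i => lt_min (hε i) (by positivity),
    fun i => min_le_right _ _, fun i => (hsub i).trans (hUV i), fun i j hij => ?_⟩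
  exact (Set.prod_mono (hsub i) (hsub j)).trans (hU (i, j) (Finset.mem_univ _) hij)

/-- Mycielski's theorem for comeagre relations. -/
theorem exists_cantor_of_mem_residual {X : Type*} [MetricSpace X] [CompleteSpace X] [Nonempty X]
    {Q : Set (X × X)} (hQ : Q ∈ residual (X × X)) :
    ∃ g : (ℕ → Bool) → X, ∀ r r', r ≠ r' → (g r, g r') ∈ Q := by
  obtain ⟨W, hWo, hWd, hW⟩ := exists_dense_open_seq hQ
  let O : ℕ → Set (X × X) := fun n => ⋂ j ∈ Finset.range (n + 1), W j
  have hOo : ∀ n, IsOpen (O n) := fun n => isOpen_biInter_finset fun j _ => hWo j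
  have hOd : ∀ n, Dense (O n) := fun n =>
    dense_biInter_of_isOpen (fun j _ => hWo j) (Finset.countable_toSet _) fun j _ => hWd j
  let St : ℕ → Type _ := fun n => {s : (Fin n → Bool) → X × ℝ // ∀ b, 0 < (s b).2}
  have hstep : ∀ n (s : St n), ∃ s' : St (n + 1), (∀ b, (s'.1 b).2 ≤ (1 / 2) ^ n) ∧
      (∀ b, Metric.closedBall (s'.1 b).1 (s'.1 b).2 ⊆
        Metric.closedBall (s.1 (fun i => b i.castSucc)).1 (s.1 (fun i => b i.castSucc)).2) ∧
      ∀ b b', b ≠ b' → Metric.closedBall (s'.1 b).1 (s'.1 b).2 ×ˢ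
        Metric.closedBall (s'.1 b').1 (s'.1 b').2 ⊆ O n := by
    intro n s
    obtain ⟨V', h1, h2, h3, h4⟩ :=
      exists_ball_refinement (ι := Fin (n + 1) → Bool) (hOo n) (hOd n) n
      (fun b => s.1 (fun i => b i.castSucc)) (fun b => s.2 _)
    exact ⟨⟨V', h1⟩, h2, fun b => (h3 b).trans Metric.ball_subset_closedBall, h4⟩
  choose step hs1 hs2 hs3 using hstep
  let s : ∀ n, St n := fun n => Nat.rec (motive := St)
    ⟨fun _ => (Classical.arbitrary X, 1), fun _ => one_pos⟩ (fun n s => step n s) n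
  have hs : ∀ n, s (n + 1) = step n (s n) := fun n => rfl
  let res : (ℕ → Bool) → ∀ n, Fin n → Bool := fun r n i => r i
  let K : (ℕ → Bool) → ℕ → Set X := fun r n =>
    Metric.closedBall ((s (n + 1)).1 (res r (n + 1))).1 ((s (n + 1)).1 (res r (n + 1))).2
  have hKanti : ∀ r, Antitone (K r) := fun r => antitone_nat_of_succ_le fun n => by
    have h1 := hs2 (n + 1) (s (n + 1)) (res r (n + 2))
    exact h1
  have hKne : ∀ r, (⋂ n, K r n).Nonempty := by
    intro r
    refine Metric.nonempty_iInter_of_nonempty_biInter (fun n => Metric.isClosed_closedBall)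
      (fun n => Metric.isBounded_closedBall) (fun N => ?_) ?_
    · refine ⟨((s (N + 1)).1 (res r (N + 1))).1, Set.mem_iInter₂.2 fun n hn => ?_⟩
      exact hKanti r hn (Metric.mem_closedBall_self ((s (N + 1)).2 _).le)
    · have hlim : Filter.Tendsto (fun n : ℕ => 2 * (1 / 2 : ℝ) ^ n) Filter.atTop (nhds 0) := by
        have := (tendsto_pow_atTop_nhds_zero_of_lt_one (r := (1 / 2 : ℝ))
          (by norm_num) (by norm_num)).const_mul 2
        simpa using this
      refine squeeze_zero (fun n => Metric.diam_nonneg) (fun n => ?_) hlim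
      refine (Metric.diam_closedBall ((s (n + 1)).2 _).le).trans ?_
      have := hs1 n (s n) (res r (n + 1))
      rw [← hs] at this
      linarith
  choose g hg using hKne
  refine ⟨g, fun r r' hne => hW (Set.mem_iInter.2 fun j => ?_)⟩
  obtain ⟨n, hn⟩ := Function.ne_iff.1 hne
  have hne' : res r (max n j + 1) ≠ res r' (max n j + 1) := fun h => by
    have := congrFun h ⟨n, by omega⟩
    exact hn this
  have h1 := hs3 (max n j) (s (max n j)) _ _ hne'
  rw [← hs] at h1
  have h2 : (g r, g r') ∈ O (max n j) :=
    h1 ⟨Set.mem_iInter.1 (hg r) (max n j), Set.mem_iInter.1 (hg r') (max n j)⟩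
  exact Set.mem_iInter₂.1 h2 j (Finset.mem_range.2 (by omega))

/-- A Borel relation with nowhere dense sections on a Polish space has perfectly many pairwise
unrelated points. -/
theorem exists_cantor_of_nowhereDense_sections {X : Type*} [TopologicalSpace X] [PolishSpace X]
    [Nonempty X] [MeasurableSpace X] [BorelSpace X] {R : Set (X × X)}
    (hR : MeasurableSet R) (hsec : ∀ t, IsNowhereDense {t' | (t, t') ∈ R}) :
    ∃ g : (ℕ → Bool) → X, ∀ r r', r ≠ r' → (g r, g r') ∉ R := by
  let _ := TopologicalSpace.upgradeIsCompletelyMetrizable X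
  exact exists_cantor_of_mem_residual (compl_mem_residual_of_sections hR hsec)

/-- Prepend a term to a sequence. -/
def seqCons {α : Type*} (a : α) (γ : ℕ → α) : ℕ → α
  | 0 => a
  | n + 1 => γ n

/-- The sets of plays in which the first player has a winning strategy reaching, after
finitely many rounds, a position with no continuation in the set. -/
inductive IsLost {Z M : Type*} : Set (ℕ → Z × M) → Prop
  | empty : IsLost ∅
  | step (Γ : Set (ℕ → Z × M)) (z : Z) (h : ∀ p, IsLost {γ | seqCons (z, p) γ ∈ Γ}) : IsLost Γ

theorem IsLost.exists_strategy {Z M : Type*} [Nonempty Z] {Γ : Set (ℕ → Z × M)} (h : IsLost Γ) :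
    ∃ S : List M → Z, ∀ p : ℕ → M, (fun i => (S ((List.range i).map p), p i)) ∉ Γ := by
  induction h with
  | empty => exact ⟨fun _ => Classical.arbitrary Z, fun p => id⟩
  | step Γ z _ ih =>
    choose S hS using ih
    refine ⟨fun l => match l with
      | [] => z
      | p :: l => S p l, fun p hp => hS (p 0) (fun i => p (i + 1)) ?_⟩
    rw [Set.mem_ofPred_eq]
    convert hp using 1
    funext i
    cases i with
    | zero => rfl
    | succ i =>
      simp only [seqCons, List.range_succ_eq_map, List.map_cons, List.map_map]
      rfl

/-- The answers given by following the choices `nxt` through the positions of the game. -/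
noncomputable def followStrategy {Z M : Type*} [Nonempty M] (nxt : Set (ℕ → Z × M) → Z → M) :
    Set (ℕ → Z × M) → List Z → M
  | _, [] => Classical.arbitrary M
  | Γ, [z] => nxt Γ z
  | Γ, z :: z' :: l => followStrategy nxt {γ | seqCons (z, nxt Γ z) γ ∈ Γ} (z' :: l)

/-- Determinacy of closed games: the first player plays in `Z`, the second in `M`, and the second
player wins the plays in the sequentially closed set `Γ`. -/
theorem exists_strategy_of_closed {Z M : Type*} [Nonempty Z] [Nonempty M] {Γ : Set (ℕ → Z × M)}
    (hΓ : ∀ γ, (∀ j, ∃ γ' ∈ Γ, ∀ i < j, γ' i = γ i) → γ ∈ Γ) :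
    (∃ σ : List Z → M, ∀ z : ℕ → Z, (fun i => (z i, σ ((List.range (i + 1)).map z))) ∈ Γ) ∨
      ∃ S : List M → Z, ∀ p : ℕ → M, (fun i => (S ((List.range i).map p), p i)) ∉ Γ := by
  by_cases hL : IsLost Γ
  · exact Or.inr hL.exists_strategy
  left
  have hnext : ∀ (Γ : Set (ℕ → Z × M)) (z : Z), ∃ p, ¬ IsLost Γ →
      ¬ IsLost {γ | seqCons (z, p) γ ∈ Γ} := by
    intro Γ z
    by_cases h : IsLost Γ
    · exact ⟨Classical.arbitrary M, fun h' => absurd h h'⟩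
    · by_contra! hcon
      exact h (IsLost.step Γ z fun p => (hcon p).2)
  choose nxt hnxt using hnext
  have key : ∀ (j : ℕ) (Γ : Set (ℕ → Z × M)) (z : ℕ → Z), ¬ IsLost Γ → ∃ γ' ∈ Γ, ∀ i < j,
      γ' i = (z i, followStrategy nxt Γ ((List.range (i + 1)).map z)) := by
    intro j
    induction j with
    | zero =>
      intro Γ z h
      have : Γ.Nonempty := by
        rw [Set.nonempty_iff_ne_empty]
        rintro rfl
        exact h IsLost.empty
      obtain ⟨γ, hγ⟩ := this
      exact ⟨γ, hγ, by simp⟩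
    | succ j ih =>
      intro Γ z h
      obtain ⟨γ, hγ, hj⟩ := ih _ (fun i => z (i + 1)) (hnxt Γ (z 0) h)
      refine ⟨_, hγ, fun i hi => ?_⟩
      cases i with
      | zero => rfl
      | succ i =>
        have h1 : (List.range (i + 1 + 1)).map z =
            z 0 :: z 1 :: (List.range i).map (fun i => z (i + 2)) := by
          simp only [List.range_succ_eq_map, List.map_cons, List.map_map]
          rfl
        have h2 : (List.range (i + 1)).map (fun i => z (i + 1)) =
            z 1 :: (List.range i).map (fun i => z (i + 2)) := by
          simp only [List.range_succ_eq_map, List.map_cons, List.map_map]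
          rfl
        show γ i = _
        rw [hj i (by omega), h1, h2]
        rfl
  exact ⟨followStrategy nxt Γ, fun z => hΓ _ fun j => key j Γ z hL⟩

instance polishSpace_pi {ι : Type*} [Countable ι] {X : ι → Type*} [∀ i, TopologicalSpace (X i)]
    [∀ i, PolishSpace (X i)] : PolishSpace (∀ i, X i) := by constructor

instance polishSpace_prod {X Y : Type*} [TopologicalSpace X] [TopologicalSpace Y]
    [PolishSpace X] [PolishSpace Y] : PolishSpace (X × Y) := by constructor

theorem MeasureTheory.AnalyticSet.inter' {X : Type*} [TopologicalSpace X] [T2Space X] {s t : Set X}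
    (hs : AnalyticSet s) (ht : AnalyticSet t) : AnalyticSet (s ∩ t) := by
  rw [Set.inter_eq_iInter]
  exact AnalyticSet.iInter fun b => by cases b <;> assumption

section

set_option linter.unusedSectionVars false

variable {B : Type*} [AddCommGroup B] (c : BorelCode B)
  {P : Type*} [TopologicalSpace P] [PolishSpace P] [MeasurableSpace P] [BorelSpace P]

/-- The relation "`y` codes the value of `F` at `p ∈ S`" is analytic. -/
def BorelCode.AnalyticOn (S : Set P) (F : P → B) : Prop :=
  AnalyticSet {z : P × Cantor | z.1 ∈ S ∧ z.2 ∈ c.Bstar ∧ c.q z.2 = F z.1}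

/-- The graph of addition on codes. -/
def BorelCode.addSet : Set (Cantor × Cantor × Cantor) := {p : Cantor × Cantor × Cantor |
    p.1 ∈ c.Bstar ∧ p.2.1 ∈ c.Bstar ∧ p.2.2 ∈ c.Bstar ∧ c.q p.1 + c.q p.2.1 = c.q p.2.2}

theorem BorelCode.analyticSet_addSet : AnalyticSet c.addSet :=
  MeasurableSet.analyticSet c.borel_add

variable {c} {S : Set P} {F G : P → B}

theorem BorelCode.analyticOn_coord (hS : MeasurableSet S) {e : P → Cantor} (he : Continuous e)
    (heS : ∀ p ∈ S, e p ∈ c.Bstar) : c.AnalyticOn S fun p => c.q (e p) := by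
  have h1 : MeasurableSet ({z : P × Cantor | z.1 ∈ S} ∩ ({z : P × Cantor | z.2 ∈ c.Bstar} ∩
      (fun z : P × Cantor => (z.2, e z.1)) ⁻¹' c.E)) :=
    (measurable_fst hS).inter ((measurable_snd c.borel_Bstar).inter
      ((measurable_snd.prodMk (he.measurable.comp measurable_fst)) c.borel_E))
  have h2 := h1.analyticSet
  unfold BorelCode.AnalyticOn
  convert h2 using 1
  ext z
  constructor
  · rintro ⟨h1, h2, h3⟩
    exact ⟨h1, h2, (c.q_eq_iff _ h2 _ (heS _ h1)).1 h3⟩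
  · rintro ⟨h1, h2, h3⟩
    exact ⟨h1, h2, (c.q_eq_iff _ h2 _ (heS _ h1)).2 h3⟩

theorem analyticSet_exists {X Y : Type*} [TopologicalSpace X] [TopologicalSpace Y]
    {R : Set (X × Y)} (hR : AnalyticSet R) : AnalyticSet {x | ∃ y, (x, y) ∈ R} := by
  convert hR.image_of_continuous continuous_fst using 1
  ext x
  simp

theorem BorelCode.AnalyticOn.add (hF : c.AnalyticOn S F) (hG : c.AnalyticOn S G) :
    c.AnalyticOn S fun p => F p + G p := by
  have h1 := hF.preimage (f := fun w : (P × Cantor) × (Cantor × Cantor) => (w.1.1, w.2.1))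
    (by fun_prop)
  have h2 := hG.preimage (f := fun w : (P × Cantor) × (Cantor × Cantor) => (w.1.1, w.2.2))
    (by fun_prop)
  have h3 := c.analyticSet_addSet.preimage
    (f := fun w : (P × Cantor) × (Cantor × Cantor) => (w.2.1, w.2.2, w.1.2)) (by fun_prop)
  have h4 := analyticSet_exists ((h1.inter' h2).inter' h3)
  unfold BorelCode.AnalyticOn
  convert h4 using 1
  ext z
  constructor
  · rintro ⟨hz, hz2, hz3⟩
    obtain ⟨s, hs, hs'⟩ := c.surj (F z.1)
    obtain ⟨t, ht, ht'⟩ := c.surj (G z.1)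
    exact ⟨(s, t), ⟨⟨hz, hs, hs'⟩, hz, ht, ht'⟩, hs, ht, hz2, by
      simp only [hs', ht', hz3]⟩
  · rintro ⟨⟨s, t⟩, ⟨⟨hz, hs, hs'⟩, -, ht, ht'⟩, -, -, hz2, h⟩
    simp only at hs' ht' h
    exact ⟨hz, hz2, by rw [← h, hs', ht']⟩

theorem BorelCode.AnalyticOn.eq (hF : c.AnalyticOn S F) (hG : c.AnalyticOn S G) :
    AnalyticSet {p | p ∈ S ∧ F p = G p} := by
  convert analyticSet_exists (hF.inter' hG) using 1
  ext p
  constructor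
  · rintro ⟨hp, h⟩
    obtain ⟨s, hs, hs'⟩ := c.surj (F p)
    exact ⟨s, ⟨hp, hs, hs'⟩, hp, hs, hs'.trans h⟩
  · rintro ⟨s, ⟨hp, hs, h1⟩, -, -, h2⟩
    exact ⟨hp, h1.symm.trans h2⟩

theorem BorelCode.analyticOn_zero (hS : MeasurableSet S) : c.AnalyticOn S fun _ => (0 : B) := by
  obtain ⟨s, hs, h0⟩ := c.surj 0
  simpa only [h0] using BorelCode.analyticOn_coord (c := c) hS (continuous_const (y := s))
    fun _ _ => hs

theorem BorelCode.AnalyticOn.neg (hF : c.AnalyticOn S F) : c.AnalyticOn S fun p => -F p := by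
  obtain ⟨o, ho, ho0⟩ := c.surj 0
  have h1 := hF.preimage (f := fun w : (P × Cantor) × Cantor => (w.1.1, w.2)) (by fun_prop)
  have h3 := c.analyticSet_addSet.preimage
    (f := fun w : (P × Cantor) × Cantor => (w.2, w.1.2, o)) (by fun_prop)
  have h4 := analyticSet_exists (h1.inter' h3)
  unfold BorelCode.AnalyticOn
  convert h4 using 1
  ext z
  constructor
  · rintro ⟨hz, hz2, hz3⟩
    obtain ⟨s, hs, hs'⟩ := c.surj (F z.1)
    exact ⟨s, ⟨hz, hs, hs'⟩, hs, hz2, ho, by simp only [hs', hz3, ho0, add_neg_cancel]⟩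
  · rintro ⟨s, ⟨hz, hs, hs'⟩, -, hz2, -, h⟩
    simp only [ho0] at hs' h
    refine ⟨hz, hz2, ?_⟩
    show c.q z.2 = -F z.1
    rw [← hs']
    exact (neg_eq_of_add_eq_zero_right h).symm

theorem BorelCode.AnalyticOn.nsmul (hS : MeasurableSet S) (hF : c.AnalyticOn S F) (n : ℕ) :
    c.AnalyticOn S fun p => n • F p := by
  induction n with
  | zero => simpa only [zero_smul] using BorelCode.analyticOn_zero hS
  | succ n ih => simpa only [succ_nsmul] using ih.add hF

theorem BorelCode.AnalyticOn.zsmul (hS : MeasurableSet S) (hF : c.AnalyticOn S F) (n : ℤ) :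
    c.AnalyticOn S fun p => n • F p := by
  cases n with
  | ofNat n => simpa only [Int.ofNat_eq_natCast, natCast_zsmul] using hF.nsmul hS n
  | negSucc n => simpa only [negSucc_zsmul] using (hF.nsmul hS (n + 1)).neg

theorem BorelCode.AnalyticOn.sum (hS : MeasurableSet S) {ι : Type*} {s : Finset ι}
    {F : ι → P → B} (hF : ∀ j ∈ s, c.AnalyticOn S (F j)) :
    c.AnalyticOn S fun p => ∑ j ∈ s, F j p := by
  classical
  induction s using Finset.induction_on with
  | empty => simpa only [Finset.sum_empty] using BorelCode.analyticOn_zero hS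
  | insert a s ha ih =>
    simpa only [Finset.sum_insert ha] using
      (hF a (Finset.mem_insert_self a s)).add (ih fun j hj => hF j (Finset.mem_insert_of_mem hj))

theorem BorelCode.analyticSet_divRel (hS : MeasurableSet S) {n : ℕ} (m : ℤ) (a : Fin n → ℤ)
    {k : P → Cantor} {x : Fin n → P → Cantor} (hk : Continuous k) (hx : ∀ j, Continuous (x j))
    (hkS : ∀ p ∈ S, k p ∈ c.Bstar) (hxS : ∀ p ∈ S, ∀ j, x j p ∈ c.Bstar) :
    AnalyticSet {p | p ∈ S ∧ DivRel m a (c.q (k p)) fun j => c.q (x j p)} := by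
  have hS' : MeasurableSet {z : P × Cantor | z.1 ∈ S ∧ z.2 ∈ c.Bstar} :=
    (measurable_fst hS).inter (measurable_snd c.borel_Bstar)
  have h1 := (BorelCode.analyticOn_coord (c := c) hS' continuous_snd fun p hp => hp.2).zsmul hS' m
  have h2 := (BorelCode.AnalyticOn.sum (s := Finset.univ) hS' fun j _ =>
    (BorelCode.analyticOn_coord (c := c) hS' ((hx j).comp continuous_fst)
      fun p hp => hxS _ hp.1 j).zsmul hS' (a j)).add
    (BorelCode.analyticOn_coord (c := c) hS' (hk.comp continuous_fst) fun p hp => hkS _ hp.1)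
  convert analyticSet_exists (h1.eq h2) using 1
  ext p
  constructor
  · rintro ⟨hp, y, hy⟩
    obtain ⟨s, hs, rfl⟩ := c.surj y
    exact ⟨s, ⟨hp, hs⟩, hy⟩
  · rintro ⟨s, ⟨hp, hs⟩, h⟩
    exact ⟨hp, _, h⟩

theorem measurableSet_isRigid {n : ℕ} {m : P → ℕ → ℤ} {a : P → ℕ → Fin n → ℤ}
    (hm : Continuous m) (ha : Continuous a) : MeasurableSet {p | IsRigid (m p) (a p)} := by
  have hc : ∀ (i : ℕ) (T : Set (ℤ × (Fin n → ℤ))),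
      MeasurableSet {p : P | (m p i, a p i) ∈ T} := fun i T =>
    ((isOpen_discrete T).preimage (f := fun p : P => (m p i, a p i)) (by fun_prop)).measurableSet
  have h : {p : P | IsRigid (m p) (a p)} = (⋂ i, {p | (m p i, a p i) ∈ {t | t.1 ≠ 0}}) ∩
      ⋂ ζ : {ζ : Fin n → ℤ // ζ ≠ 0}, ⋃ i,
        {p | (m p i, a p i) ∈ {t | ¬ t.1 ∣ ∑ j, t.2 j * ζ.1 j}} := by
    ext p
    simp only [IsRigid, Set.mem_inter_iff, Set.mem_iInter, Set.mem_iUnion, Set.mem_ofPred_eq,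
      Subtype.forall]
    refine and_congr_right fun _ => forall_congr' fun ζ => ?_
    rw [← not_imp_not, not_forall]
  rw [h]
  exact (MeasurableSet.iInter fun i => hc i _).inter
    (MeasurableSet.iInter fun ζ => MeasurableSet.iUnion fun i => hc i _)

theorem BorelCode.analyticSet_rigid {n : ℕ} {m : P → ℕ → ℤ} {a : P → ℕ → Fin n → ℤ}
    {k : P → ℕ → Cantor} {x : P → Fin n → Cantor}
    (hm : Continuous m) (ha : Continuous a) (hk : Continuous k) (hx : Continuous x) :
    AnalyticSet {p | IsRigid (m p) (a p) ∧ (∀ i, k p i ∈ c.Bstar) ∧ (∀ j, x p j ∈ c.Bstar) ∧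
      ∀ i, DivRel (m p i) (a p i) (c.q (k p i)) fun j => c.q (x p j)} := by
  have hS : MeasurableSet {p : P | (∀ i, k p i ∈ c.Bstar) ∧ ∀ j, x p j ∈ c.Bstar} := by
    have : {p : P | (∀ i, k p i ∈ c.Bstar) ∧ ∀ j, x p j ∈ c.Bstar} =
        (⋂ i, (fun p => k p i) ⁻¹' c.Bstar) ∩ ⋂ j, (fun p => x p j) ⁻¹' c.Bstar := by
      ext p; simp
    rw [this]
    exact (MeasurableSet.iInter fun i =>
      (by fun_prop : Continuous fun p => k p i).measurable c.borel_Bstar).inter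
      (MeasurableSet.iInter fun j =>
        (by fun_prop : Continuous fun p => x p j).measurable c.borel_Bstar)
  have h1 : ∀ i, AnalyticSet (⋃ t : ℤ × (Fin n → ℤ), {p : P | (m p i, a p i) ∈ ({t} : Set _)} ∩
      {p | p ∈ {p : P | (∀ i, k p i ∈ c.Bstar) ∧ ∀ j, x p j ∈ c.Bstar} ∧
        DivRel t.1 t.2 (c.q (k p i)) fun j => c.q (x p j)}) := fun i =>
    AnalyticSet.iUnion fun t => AnalyticSet.inter'
      ((isOpen_discrete {t}).preimage (f := fun p : P => (m p i, a p i))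
        (by fun_prop)).measurableSet.analyticSet
      (BorelCode.analyticSet_divRel hS t.1 t.2 (by fun_prop) (by fun_prop)
        (fun p hp => hp.1 i) fun p hp => hp.2)
  convert (measurableSet_isRigid hm ha).analyticSet.inter' (hS.analyticSet.inter'
    (AnalyticSet.iInter h1)) using 1
  ext p
  simp only [Set.mem_inter_iff, Set.mem_iInter, Set.mem_iUnion, Set.mem_ofPred_eq,
    Set.mem_singleton_iff]
  constructor
  · rintro ⟨h, h2, h3, h4⟩
    exact ⟨h, ⟨h2, h3⟩, fun i => ⟨_, rfl, ⟨h2, h3⟩, h4 i⟩⟩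
  · rintro ⟨h, ⟨h2, h3⟩, h4⟩
    refine ⟨h, h2, h3, fun i => ?_⟩
    obtain ⟨t, rfl, -, h5⟩ := h4 i
    exact h5

end

/-- Sequences of coded divisibility conditions together with a coded tuple. -/
abbrev RigidData (n : ℕ) : Type := (ℕ → ℤ × (Fin n → ℤ) × Cantor) × (Fin n → Cantor)

theorem BorelCode.exists_continuous_range {B : Type*} [AddCommGroup B] (c : BorelCode B) (n : ℕ) :
    {p : RigidData n | IsRigid (fun i => (p.1 i).1) (fun i => (p.1 i).2.1) ∧
      (∀ i, (p.1 i).2.2 ∈ c.Bstar) ∧ (∀ j, p.2 j ∈ c.Bstar) ∧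
      ∀ i, DivRel (p.1 i).1 (p.1 i).2.1 (c.q (p.1 i).2.2) fun j => c.q (p.2 j)} = ∅ ∨
    ∃ f : (ℕ → ℕ) → RigidData n, Continuous f ∧ Set.range f =
    {p : RigidData n | IsRigid (fun i => (p.1 i).1) (fun i => (p.1 i).2.1) ∧
      (∀ i, (p.1 i).2.2 ∈ c.Bstar) ∧ (∀ j, p.2 j ∈ c.Bstar) ∧
      ∀ i, DivRel (p.1 i).1 (p.1 i).2.1 (c.q (p.1 i).2.2) fun j => c.q (p.2 j)} := by
  let _ : MeasurableSpace (RigidData n) := borel _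
  have : BorelSpace (RigidData n) := ⟨rfl⟩
  have : PolishSpace (RigidData n) := polishSpace_prod
  have := BorelCode.analyticSet_rigid (c := c) (P := RigidData n)
    (m := fun p i => (p.1 i).1) (a := fun p i => (p.1 i).2.1) (k := fun p i => (p.1 i).2.2)
    (x := fun p => p.2) (by fun_prop) (by fun_prop) (by fun_prop) (by fun_prop)
  rwa [AnalyticSet] at this

theorem BorelCode.exists_continuous_range_compl {B : Type*} [AddCommGroup B] (c : BorelCode B) :
    c.Eᶜ = ∅ ∨ ∃ f : (ℕ → ℕ) → Cantor × Cantor, Continuous f ∧ Set.range f = c.Eᶜ := by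
  have := c.borel_E.compl.analyticSet
  rwa [AnalyticSet] at this

theorem exists_forall_eq_imp_mem_of_isOpen {U : Set (ℕ → ℕ)} (hU : IsOpen U)
    {t : ℕ → ℕ} (ht : t ∈ U) :
    ∃ k, ∀ t', (∀ i < k, t' i = t i) → t' ∈ U := by
  obtain ⟨v, ⟨y, k, rfl⟩, hy, hs⟩ :=
    (PiNat.isTopologicalBasis_cylinders fun _ => ℕ).exists_subset_of_mem_open ht hU
  rw [PiNat.mem_cylinder_iff] at hy
  refine ⟨k, fun t' h => hs ?_⟩
  rw [PiNat.mem_cylinder_iff]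
  exact fun i hi => (h i hi).trans (hy i hi)

theorem exists_mem_forall_lt_eq_of_mem_closure {T : Set (ℕ → ℕ)} {t : ℕ → ℕ} (ht : t ∈ closure T)
    (k : ℕ) : ∃ t' ∈ T, ∀ i < k, t' i = t i := by
  obtain ⟨t', h1, h2⟩ := mem_closure_iff.1 ht _ (PiNat.isOpen_cylinder (fun _ => ℕ) t k)
    (PiNat.self_mem_cylinder t k)
  exact ⟨t', h2, fun i hi => (PiNat.mem_cylinder_iff.1 h1) i hi⟩

theorem continuous_of_finite_dependence (g : (ℕ → ℕ) → ℕ) (k : ℕ)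
    (h : ∀ t t', (∀ i < k, t i = t' i) → g t = g t') : Continuous g := by
  have : g = (fun p : Fin k → ℕ => g fun i => if hi : i < k then p ⟨i, hi⟩ else 0) ∘
      fun t i => t i := by
    funext t
    refine h _ _ fun i hi => ?_
    simp [hi]
  rw [this]
  exact continuous_of_discreteTopology.comp (by fun_prop)

/-- Closedness under a set-valued operation on finite lists. -/
def ListClosed {B : Type*} (Φ : List B → Set B) (s : Set B) : Prop :=
  ∀ l : List B, (∀ b ∈ l, b ∈ s) → Φ l ⊆ s

/-- The closure of a set under a set-valued operation on finite lists. -/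
def listClosure {B : Type*} (Φ : List B → Set B) (s : Set B) : Set B :=
  ⋂₀ {t | s ⊆ t ∧ ListClosed Φ t}

theorem subset_listClosure {B : Type*} (Φ : List B → Set B) (s : Set B) :
    s ⊆ listClosure Φ s := fun _ hb _ ht => ht.1 hb

theorem listClosed_listClosure {B : Type*} (Φ : List B → Set B) (s : Set B) :
    ListClosed Φ (listClosure Φ s) := fun l hl _ hb t ht =>
  ht.2 l (fun b hb => hl b hb t ht) hb

theorem listClosure_mono {B : Type*} (Φ : List B → Set B) {s t : Set B} (h : s ⊆ t) :
    listClosure Φ s ⊆ listClosure Φ t := fun _ hb r hr => hb r ⟨h.trans hr.1, hr.2⟩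

theorem listClosed_iUnion {B ι : Type*} [Nonempty ι] {Φ : List B → Set B} {s : ι → Set B}
    (hs : Directed (· ⊆ ·) s) (h : ∀ i, ListClosed Φ (s i)) : ListClosed Φ (⋃ i, s i) := by
  intro l hl
  obtain ⟨i, hi⟩ : ∃ i, ∀ b ∈ l, b ∈ s i := by
    clear h
    induction l with
    | nil => exact ⟨Classical.arbitrary ι, by simp⟩
    | cons a l ih =>
      obtain ⟨i, hi⟩ := ih fun b hb => hl b (List.mem_cons_of_mem a hb)
      obtain ⟨j, hj⟩ := Set.mem_iUnion.1 (hl a List.mem_cons_self)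
      obtain ⟨k, hik, hjk⟩ := hs i j
      refine ⟨k, fun b hb => ?_⟩
      rcases List.mem_cons.1 hb with rfl | hb
      · exact hjk hj
      · exact hik (hi b hb)
  exact (h i l hi).trans (Set.subset_iUnion s i)

theorem countable_listClosure {B : Type*} {Φ : List B → Set B} (hΦ : ∀ l, (Φ l).Countable)
    {s : Set B} (hs : s.Countable) : (listClosure Φ s).Countable := by
  let T : ℕ → Set B := fun k => Nat.rec s
    (fun _ T => T ∪ ⋃ l ∈ {l : List B | ∀ b ∈ l, b ∈ T}, Φ l) k
  have hT : ∀ k, (T k).Countable := by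
    intro k
    induction k with
    | zero => exact hs
    | succ k ih =>
      have := ih.to_subtype
      refine ih.union (Set.Countable.biUnion ?_ fun l _ => hΦ l)
      rw [← Set.range_list_map_coe]
      exact Set.countable_range _
  have hmono : Monotone T := monotone_nat_of_le_succ fun k => Set.subset_union_left
  have h1 : s ⊆ ⋃ k, T k := Set.subset_iUnion T 0
  refine (Set.countable_iUnion hT).mono fun b hb => hb _ ⟨h1, ?_⟩
  intro l hl b hb
  obtain ⟨k, hk⟩ : ∃ k, ∀ b ∈ l, b ∈ T k := by
    clear hb
    induction l with
    | nil => exact ⟨0, by simp⟩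
    | cons a l ih =>
      obtain ⟨i, hi⟩ := ih fun b hb => hl b (List.mem_cons_of_mem a hb)
      obtain ⟨j, hj⟩ := Set.mem_iUnion.1 (hl a List.mem_cons_self)
      refine ⟨max i j, fun b hb => ?_⟩
      rcases List.mem_cons.1 hb with rfl | hb
      · exact hmono (le_max_right i j) hj
      · exact hmono (le_max_left i j) (hi b hb)
  exact Set.mem_iUnion.2 ⟨k + 1, Or.inr (Set.mem_biUnion (x := l) hk hb)⟩

theorem countable_span {A : Type*} [AddCommGroup A] {s : Set A} (hs : s.Countable) :
    Countable (Submodule.span ℤ s) := by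
  have := hs.to_subtype
  have h : Countable (Submodule.span ℤ (Set.range ((↑) : s → A))) := inferInstance
  rwa [Subtype.range_coe] at h

section NoResponse

variable {B : Type u} [AddCommGroup B] {n : ℕ}

/-- Extensions inside `K` of the position `s` reach the value `x₀` of `x` from every further
position. -/
def Recurs (x : (ℕ → B) → Fin (n + 1) → B) (K : Set B) (s : List B) (x₀ : Fin (n + 1) → B) :
    Prop :=
  (∀ b ∈ s, b ∈ K) ∧ ∀ y : ℕ → B, (∀ i, y i ∈ K) → (List.range s.length).map y = s → ∀ k,
    ∃ z : ℕ → B, (∀ i, z i ∈ K) ∧ (∀ i < k, z i = y i) ∧ x z = x₀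

theorem map_range_congr {α : Type*} {y z : ℕ → α} {k : ℕ} (h : ∀ i < k, y i = z i) :
    (List.range k).map y = (List.range k).map z :=
  List.map_congr_left fun i hi => h i (List.mem_range.1 hi)

theorem map_range_eq_iff {α : Type*} {y z : ℕ → α} {k : ℕ} :
    (List.range k).map y = (List.range k).map z ↔ ∀ i < k, y i = z i := by
  simp

theorem exists_map_range_eq {α : Type*} {K : Set α} (hK : K.Nonempty) {s : List α}
    (hs : ∀ b ∈ s, b ∈ K) :
    ∃ y : ℕ → α, (∀ i, y i ∈ K) ∧ (List.range s.length).map y = s := by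
  obtain ⟨b, hb⟩ := hK
  refine ⟨fun i => s.getD i b, fun i => ?_, ?_⟩
  · by_cases hi : i < s.length
    · simp only [List.getD_eq_getElem _ _ hi]
      exact hs _ (List.getElem_mem hi)
    · simp only [List.getD_eq_default _ _ (not_lt.1 hi)]
      exact hb
  · refine List.ext_getElem (by simp) fun i h1 h2 => ?_
    simp [List.getElem?_eq_getElem h2]

variable {w : List B → ℤ × (Fin (n + 1) → ℤ) × B} {x : (ℕ → B) → Fin (n + 1) → B}

theorem Recurs.eq (hB : LiftsCharacters B)
    (hr : ∀ z : ℕ → B, IsRigid (fun i => (w ((List.range (i + 1)).map z)).1)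
      fun i => (w ((List.range (i + 1)).map z)).2.1)
    (hd : ∀ (z : ℕ → B) i, DivRel (w ((List.range (i + 1)).map z)).1
      (w ((List.range (i + 1)).map z)).2.1 (w ((List.range (i + 1)).map z)).2.2 (x z))
    {K K' : Set B} (hK : K.Nonempty) (hKK' : K ⊆ K') {s : List B} {x₁ x₂ : Fin (n + 1) → B}
    (h₁ : Recurs x K s x₁) (h₂ : Recurs x K' s x₂) : x₁ = x₂ := by
  obtain ⟨y, hyK, hys⟩ := exists_map_range_eq hK h₁.1
  obtain ⟨z, hzK, hzy, rfl⟩ := h₁.2 y hyK hys s.length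
  refine hB.divRel_unique (hr z) (hd z) fun i => ?_
  obtain ⟨z', -, hz', rfl⟩ := h₂.2 z (fun i => hKK' (hzK i))
    ((map_range_congr hzy).trans hys) (i + 1)
  rw [← map_range_congr hz']
  exact hd z' i

theorem exists_countable_closed_forall_not_recurs (hB : LiftsCharacters B)
    (hr : ∀ z : ℕ → B, IsRigid (fun i => (w ((List.range (i + 1)).map z)).1)
      fun i => (w ((List.range (i + 1)).map z)).2.1)
    (hd : ∀ (z : ℕ → B) i, DivRel (w ((List.range (i + 1)).map z)).1
      (w ((List.range (i + 1)).map z)).2.1 (w ((List.range (i + 1)).map z)).2.2 (x z))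
    (hne : ∀ z i, x z 0 ≠ z i) :
    ∃ N : Set B, N.Countable ∧ N.Nonempty ∧ ListClosed (fun l => {(w l).2.2}) N ∧
      ∀ s x₀, ¬ Recurs x N s x₀ := by
  have hch : ∀ s : List B, ∃ K : Set B, K.Countable ∧ ∃ x₀, (∃ K' : Set B, K'.Countable ∧
      K'.Nonempty ∧ ∃ x₁, Recurs x K' s x₁) → K.Nonempty ∧ Recurs x K s x₀ := by
    intro s
    by_cases h : ∃ K' : Set B, K'.Countable ∧ K'.Nonempty ∧ ∃ x₁, Recurs x K' s x₁
    · obtain ⟨K, h1, h2, x₁, h3⟩ := h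
      exact ⟨K, h1, x₁, fun _ => ⟨h2, h3⟩⟩
    · exact ⟨∅, Set.countable_empty, 0, fun h' => absurd h' h⟩
  choose K hKc X hX using hch
  let Φ : List B → Set B := fun l => {(w l).2.2} ∪ K l ∪ {X l 0}
  have hΦ : ∀ l, (Φ l).Countable := fun l =>
    ((Set.countable_singleton _).union (hKc l)).union (Set.countable_singleton _)
  have hcl := listClosed_listClosure Φ {0}
  refine ⟨listClosure Φ {0}, countable_listClosure hΦ (Set.countable_singleton _),
    ⟨0, subset_listClosure Φ _ rfl⟩, fun l hl => ?_, fun s x₀ hs => ?_⟩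
  · exact (Set.subset_union_left.trans Set.subset_union_left).trans (hcl l hl)
  · set N := listClosure Φ {0}
    have hN0 : N.Nonempty := ⟨0, subset_listClosure Φ _ rfl⟩
    obtain ⟨h1, h2⟩ := hX s ⟨N, countable_listClosure hΦ (Set.countable_singleton _), hN0, _, hs⟩
    have hKN : K s ⊆ N := (Set.subset_union_right.trans Set.subset_union_left).trans (hcl s hs.1)
    have hXN : X s 0 ∈ N := hcl s hs.1 (Or.inr rfl)
    rw [Recurs.eq hB hr hd h1 hKN h2 hs] at hXN
    obtain ⟨y, hyK, hys⟩ := exists_map_range_eq hN0 hs.1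
    obtain ⟨z, -, hz, rfl⟩ := hs.2 (fun i => if i < s.length then y i else x₀ 0)
      (fun i => by split_ifs; exacts [hyK i, hXN])
      ((map_range_congr fun i hi => by simp [hi]).trans hys) (s.length + 1)
    have := hz s.length (Nat.lt_succ_self _)
    simp only [lt_irrefl, if_false] at this
    exact hne z s.length this.symm

theorem not_continuous_response (c : BorelCode B) (hB : LiftsCharacters B) (u : List B → ℕ)
    {f : (ℕ → ℕ) → Fin (n + 1) → Cantor} (hf : Continuous f) {X : (ℕ → B) → Fin (n + 1) → Cantor}
    (hX : ∀ z, X z = f fun i => u ((List.range (i + 1)).map z))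
    (hXc : ∀ z j, X z j ∈ c.Bstar)
    (hr : ∀ z : ℕ → B, IsRigid (fun i => (w ((List.range (i + 1)).map z)).1)
      fun i => (w ((List.range (i + 1)).map z)).2.1)
    (hd : ∀ (z : ℕ → B) i, DivRel (w ((List.range (i + 1)).map z)).1
      (w ((List.range (i + 1)).map z)).2.1 (w ((List.range (i + 1)).map z)).2.2
      fun j => c.q (X z j))
    (hne : ∀ z i, c.q (X z 0) ≠ z i) : False := by
  obtain ⟨N, hNc, hN0, hNw, hN⟩ := exists_countable_closed_forall_not_recurs
    (x := fun z j => c.q (X z j)) hB hr hd hne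
  obtain ⟨e, rfl⟩ := hNc.exists_eq_range hN0
  let R : Set ((ℕ → ℕ) × (ℕ → ℕ)) :=
    {p | (fun j => c.q (X (e ∘ p.1) j)) = fun j => c.q (X (e ∘ p.2) j)}
  have hcont : Continuous fun t : ℕ → ℕ => X (e ∘ t) := by
    simp only [hX]
    refine hf.comp (continuous_pi fun i => continuous_of_finite_dependence _ (i + 1)
      fun t t' h => ?_)
    exact congrArg u (map_range_congr fun k hk => congrArg e (h k hk))
  have hR : MeasurableSet R := by
    have : R = ⋂ j, (fun p : (ℕ → ℕ) × (ℕ → ℕ) => (X (e ∘ p.1) j, X (e ∘ p.2) j)) ⁻¹' c.E := by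
      ext p
      simp only [R, Set.mem_iInter, Set.mem_preimage, Set.mem_ofPred_eq]
      rw [funext_iff]
      exact forall_congr' fun j => c.q_eq_iff _ (hXc _ _) _ (hXc _ _)
    rw [this]
    refine MeasurableSet.iInter fun j => Continuous.measurable ?_ c.borel_E
    exact ((continuous_apply j).comp (hcont.comp continuous_fst)).prodMk
      ((continuous_apply j).comp (hcont.comp continuous_snd))
  have hsec : ∀ t, IsNowhereDense {t' | (t, t') ∈ R} := by
    intro t
    unfold IsNowhereDense
    by_contra hcon
    obtain ⟨t₀, ht₀⟩ := Set.nonempty_iff_ne_empty.2 hcon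
    obtain ⟨k, hk⟩ := exists_forall_eq_imp_mem_of_isOpen isOpen_interior ht₀
    refine hN ((List.range k).map (e ∘ t₀)) (fun j => c.q (X (e ∘ t) j)) ⟨by simp, ?_⟩
    intro y hy hys l
    choose t₁ ht₁ using hy
    rw [List.length_map, List.length_range, map_range_eq_iff] at hys
    obtain ⟨t₂, h2, h3⟩ := exists_mem_forall_lt_eq_of_mem_closure
      (interior_subset (hk (fun i => if i < k then t₀ i else t₁ i) fun i hi => by simp [hi])) l
    refine ⟨e ∘ t₂, fun i => ⟨_, rfl⟩, fun i hi => ?_, h2.symm⟩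
    rw [Function.comp_apply, h3 i hi]
    split_ifs with h
    · exact (hys i h).symm
    · exact ht₁ i
  obtain ⟨g, hg⟩ := exists_cantor_of_nowhereDense_sections hR hsec
  let K : Submodule ℤ B := Submodule.span ℤ (Set.range e)
  have hwK : ∀ (t : ℕ → ℕ) i, (w ((List.range (i + 1)).map (e ∘ t))).2.2 ∈ K := fun t i =>
    Submodule.subset_span (hNw _ (by simp) rfl)
  choose y hy using fun r : ULift.{u} (ℕ → Bool) => hd (e ∘ g r.down)
  let D : ULift.{u} (ℕ → Bool) → Submodule ℤ (B ⧸ K) := fun r =>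
    Submodule.span ℤ (Set.range (fun j => K.mkQ (c.q (X (e ∘ g r.down) j))) ∪
      Set.range fun i => K.mkQ (y r i))
  have hDc : ∀ r, Countable (D r) := fun r =>
    countable_span ((Set.countable_range _).union (Set.countable_range _))
  have h1 := hB.mk_iSup_lt_continuum K D hDc fun r => by
    refine (hr (e ∘ g r.down)).homIntTrivial _ _ fun i => ?_
    rw [← map_smul, hy, map_add, map_sum]
    simp only [map_smul]
    rw [Submodule.mkQ_apply K (w _).2.2, (Submodule.Quotient.mk_eq_zero K).2 (hwK _ i), add_zero]
  let S : Set B := {b | K.mkQ b ∈ ⨆ r, D r}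
  have hS : #S < 𝔠 := by
    have hle : #S ≤ #(⨆ r, D r : Submodule ℤ (B ⧸ K)) * ℵ₀ := by
      refine mk_le_mk_mul_of_mk_preimage_le (fun b : S => (⟨K.mkQ b.1, b.2⟩ :
        (⨆ r, D r : Submodule ℤ (B ⧸ K)))) fun a => ?_
      have hinj : ∀ b₀ : S, K.mkQ b₀.1 = a.1 → #((fun b : S => (⟨K.mkQ b.1, b.2⟩ :
        (⨆ r, D r : Submodule ℤ (B ⧸ K)))) ⁻¹' {a}) ≤ #K := by
        intro b₀ hb₀
        refine mk_le_of_injective (f := fun b => (⟨b.1.1 - b₀.1, ?_⟩ : K)) ?_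
        · have : K.mkQ b.1.1 = a.1 := congrArg Subtype.val b.2
          rw [← Submodule.Quotient.mk_eq_zero K, Submodule.Quotient.mk_sub]
          exact sub_eq_zero.2 (this.trans hb₀.symm)
        · intro b b' hbb
          have := congrArg Subtype.val hbb
          exact Subtype.ext (Subtype.ext (sub_left_injective this))
      by_cases h : ∃ b₀ : S, K.mkQ b₀.1 = a.1
      · obtain ⟨b₀, hb₀⟩ := h
        exact (hinj b₀ hb₀).trans (mk_le_aleph0 (α := K))
      · have : IsEmpty ((fun b : S => (⟨K.mkQ b.1, b.2⟩ :
            (⨆ r, D r : Submodule ℤ (B ⧸ K)))) ⁻¹' {a}) :=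
          ⟨fun b => h ⟨b.1, congrArg Subtype.val b.2⟩⟩
        rw [mk_eq_zero]
        exact zero_le
    exact hle.trans_lt (mul_lt_of_lt aleph0_le_continuum h1 aleph0_lt_continuum)
  have hinj : Function.Injective fun (r : ULift.{u} (ℕ → Bool)) (j : Fin (n + 1)) =>
      (⟨c.q (X (e ∘ g r.down) j), Submodule.mem_iSup_of_mem r
        (Submodule.subset_span (Or.inl ⟨j, rfl⟩))⟩ : S) := by
    intro r r' h
    by_contra hne'
    refine hg r.down r'.down (fun h' => hne' (ULift.down_injective h')) ?_
    funext j
    exact congrArg Subtype.val (congrFun h j)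
  have h2 := mk_le_of_injective hinj
  have h3 : #(ULift.{u} (ℕ → Bool)) = 𝔠 := by simp
  have h4 : #(Fin (n + 1) → S) < 𝔠 := by
    have : #(Fin (n + 1) → S) = #S ^ ((n + 1 : ℕ) : Cardinal) := by simp
    rw [this]
    exact (power_nat_le_max (c := #S) (n := n + 1)).trans_lt (max_lt hS aleph0_lt_continuum)
  exact absurd (h3 ▸ h2) (not_le.2 h4)

end NoResponse

section

open Filter Topology

theorem exists_seq_eq_map_range {M : Type*} (F : ℕ → List M → M) :
    ∃ p : ℕ → M, ∀ i, p i = F i ((List.range i).map p) := by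
  let L : ℕ → List M := fun i => Nat.rec [] (fun i l => l ++ [F i l]) i
  refine ⟨fun i => F i (L i), fun i => ?_⟩
  have : ∀ i, (List.range i).map (fun i => F i (L i)) = L i := by
    intro i
    induction i with
    | zero => rfl
    | succ i ih => rw [List.range_succ, List.map_append, ih]; rfl
  rw [this]

/-- There is no rigid system of divisibility conditions with parameters in `K` having a solution
outside `K`. -/
def IsGood {B : Type*} [AddCommGroup B] (n : ℕ) (K : Submodule ℤ B) : Prop :=
  ∀ (x : Fin (n + 1) → B) (m : ℕ → ℤ) (a : ℕ → Fin (n + 1) → ℤ) (k : ℕ → B), (∀ i, k i ∈ K) →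
    IsRigid m a → (∀ i, DivRel (m i) (a i) (k i) x) → x 0 ∈ K

theorem exists_listClosed_isGood {B : Type u} [AddCommGroup B] (c : BorelCode B)
    (hB : LiftsCharacters B) (n : ℕ) :
    ∃ Φ : List B → Set B, (∀ l, (Φ l).Countable) ∧
      ∀ K : Submodule ℤ B, ListClosed Φ K → IsGood n K := by
  choose d hd hqd using c.surj
  have hmem : ∀ (x : Fin (n + 1) → B) (m : ℕ → ℤ) (a : ℕ → Fin (n + 1) → ℤ) (k : ℕ → B),
      IsRigid m a → (∀ i, DivRel (m i) (a i) (k i) x) →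
      ((fun i => (m i, a i, d (k i)), fun j => d (x j)) : RigidData (n + 1)) ∈
      {p : RigidData (n + 1) | IsRigid (fun i => (p.1 i).1) (fun i => (p.1 i).2.1) ∧
      (∀ i, (p.1 i).2.2 ∈ c.Bstar) ∧ (∀ j, p.2 j ∈ c.Bstar) ∧
      ∀ i, DivRel (p.1 i).1 (p.1 i).2.1 (c.q (p.1 i).2.2) fun j => c.q (p.2 j)} :=
    fun x m a k h1 h2 => ⟨h1, fun i => hd _, fun j => hd _, fun i => by simpa only [hqd] using h2 i⟩
  rcases c.exists_continuous_range (n + 1) with h0 | ⟨f, hf, hfr⟩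
  · refine ⟨fun _ => ∅, fun _ => Set.countable_empty, fun K _ x m a k hk h1 h2 => ?_⟩
    have := hmem x m a k h1 h2
    rw [h0] at this
    exact absurd this (Set.notMem_empty _)
  have hf' := fun t => hfr.subset (Set.mem_range_self (f := f) t)
  rcases c.exists_continuous_range_compl with h0 | ⟨f₁, hf₁, hfr₁⟩
  · refine ⟨fun _ => ∅, fun _ => Set.countable_empty, fun K _ x m a k hk h1 h2 => ?_⟩
    have : x 0 = 0 := by
      rw [← hqd (x 0), ← hqd 0, c.q_eq_iff _ (hd _) _ (hd _)]
      rw [Set.compl_empty_iff] at h0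
      rw [h0]
      trivial
    rw [this]
    exact K.zero_mem
  let Γ : Set (ℕ → B × (ℤ × (Fin (n + 1) → ℤ) × B) × ℕ × ℕ) :=
    {γ | (∀ i, (f fun i => (γ i).2.2.1).1 i =
        ((γ i).2.1.1, (γ i).2.1.2.1, d (γ i).2.1.2.2)) ∧
      ∀ j, f₁ (fun l => (γ (Nat.pair j l)).2.2.2) = ((f fun i => (γ i).2.2.1).2 0, d (γ j).1)}
  have hΓ : ∀ γ, (∀ j, ∃ γ' ∈ Γ, ∀ i < j, γ' i = γ i) → γ ∈ Γ := by
    intro γ hγ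
    choose γ' h1 h2 using hγ
    have hev : ∀ i, ∀ᶠ j in atTop, γ' j i = γ i := fun i =>
      (eventually_gt_atTop i).mono fun j hj => h2 j i hj
    have hlim : ∀ (e : ℕ → ℕ) (g : B × (ℤ × (Fin (n + 1) → ℤ) × B) × ℕ × ℕ → ℕ),
        Tendsto (fun j i => g (γ' j (e i))) atTop (𝓝 fun i => g (γ (e i))) := fun e g =>
      tendsto_pi_nhds.2 fun i => tendsto_const_nhds.congr'
        ((hev (e i)).mono fun j hj => congrArg g hj.symm)
    have hlf := (hf.tendsto _).comp (hlim (fun i => i) fun b => b.2.2.1)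
    constructor
    · intro i
      refine tendsto_nhds_unique
        (((continuous_apply i).comp continuous_fst).continuousAt.tendsto.comp hlf) ?_
      refine tendsto_const_nhds.congr' ((hev i).mono fun j hj => ?_)
      rw [← hj]
      exact ((h1 j).1 i).symm
    · intro j
      refine tendsto_nhds_unique
        ((hf₁.tendsto _).comp (hlim (fun l => Nat.pair j l) fun b => b.2.2.2))
        ?_
      refine Tendsto.congr' ((hev j).mono fun i hi => ?_)
        (((((continuous_apply 0).comp continuous_snd).continuousAt.tendsto.comp hlf)).prodMk_nhds
          (tendsto_const_nhds (x := d (γ j).1)))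
      rw [← hi]
      exact ((h1 i).2 j).symm
  rcases exists_strategy_of_closed hΓ with ⟨σ, hσ⟩ | ⟨S, hS⟩
  · exfalso
    have h1 : ∀ (z : ℕ → B) i, (f fun i => (σ ((List.range (i + 1)).map z)).2.1).1 i =
        ((σ ((List.range (i + 1)).map z)).1.1, (σ ((List.range (i + 1)).map z)).1.2.1,
          d (σ ((List.range (i + 1)).map z)).1.2.2) := fun z => (hσ z).1
    refine not_continuous_response (w := fun l => (σ l).1) c hB (fun l => (σ l).2.1)
      (continuous_snd.comp hf)
      (X := fun z => (f fun i => (σ ((List.range (i + 1)).map z)).2.1).2)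
      (fun z => rfl) (fun z => (hf' _).2.2.1) (fun z => ?_) (fun z i => ?_) fun z i hz => ?_
    · simpa only [h1] using (hf' fun i => (σ ((List.range (i + 1)).map z)).2.1).1
    · simpa only [h1, hqd] using (hf' fun i => (σ ((List.range (i + 1)).map z)).2.1).2.2.2 i
    · have h2 := (hσ z).2 i
      have h3 := hfr₁.subset (Set.mem_range_self (f := f₁)
        fun l => (σ ((List.range (Nat.pair i l + 1)).map z)).2.2)
      simp only at h2
      rw [h2] at h3
      refine h3 ((c.q_eq_iff _ ((hf' _).2.2.1 0) _ (hd _)).1 ?_)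
      rw [hqd]
      exact hz
  · let Z : List B → List ((ℤ × (Fin (n + 1) → ℤ)) × ℕ × ℕ) →
        List ((ℤ × (Fin (n + 1) → ℤ) × B) × ℕ × ℕ) :=
      List.zipWith fun b e => ((e.1.1, e.1.2, b), e.2)
    refine ⟨fun l => Set.range fun e => S (Z l e), fun l => Set.countable_range _,
      fun K hK x m a k hk h1 h2 => ?_⟩
    by_contra hx
    obtain ⟨α, hα⟩ := hfr.superset (hmem x m a k h1 h2)
    have hβ : ∀ b : B, ∃ β, b ∈ K → f₁ β = (d (x 0), d b) := by
      intro b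
      by_cases hb : b ∈ K
      · have : (d (x 0), d b) ∈ c.Eᶜ := by
          intro h
          rw [← c.q_eq_iff _ (hd _) _ (hd _), hqd, hqd] at h
          exact hx (h ▸ hb)
        obtain ⟨β, h⟩ := hfr₁.superset this
        exact ⟨β, fun _ => h⟩
      · exact ⟨0, fun h => absurd h hb⟩
    choose β hβ using hβ
    obtain ⟨p, hp⟩ := exists_seq_eq_map_range fun i L =>
      (((m i, a i, k i), α i, β (S (L.take (Nat.unpair i).1)) (Nat.unpair i).2) :
        (ℤ × (Fin (n + 1) → ℤ) × B) × ℕ × ℕ)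
    have hz : ∀ j, S ((List.range j).map p) ∈ K := by
      intro j
      refine hK ((List.range j).map k) (by simpa using fun i _ => hk i)
        ⟨(List.range j).map fun i => (((p i).1.1, (p i).1.2.1), (p i).2), ?_⟩
      simp only [Z, List.zipWith_map, List.zipWith_self]
      refine congrArg S (List.map_congr_left fun i _ => ?_)
      rw [hp]
    refine hS p ⟨fun i => ?_, fun j => ?_⟩
    · have : (fun i => (p i).2.1) = α := funext fun i => by rw [hp]
      simp only [this, hα]
      rw [hp]
    · have : (fun i => (p i).2.1) = α := funext fun i => by rw [hp]
      simp only [this, hα]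
      rw [← hβ _ (hz j)]
      refine congrArg f₁ (funext fun l => ?_)
      rw [hp]
      simp only [Nat.unpair_pair]
      rw [← List.map_take, List.take_range, min_eq_left (Nat.left_le_pair j l)]

end

/-- The union of a well-ordered chain of submodules with free successive quotients is free. -/
theorem free_iSup_of_free_quotients {M ι : Type*} [AddCommGroup M] [LinearOrder ι]
    [WellFoundedLT ι] (F : ι → Submodule ℤ M)
    (hfree : ∀ i, Module.Free ℤ ((F i).map (⨆ j : Set.Iio i, F j).mkQ)) :
    Module.Free ℤ (⨆ i, F i : Submodule ℤ M) := by
  let L : ι → Submodule ℤ M := fun i => ⨆ j : Set.Iio i, F j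
  let β : ∀ i, Module.Basis _ ℤ ((F i).map (L i).mkQ) := fun i =>
    Module.Free.chooseBasis ℤ ((F i).map (L i).mkQ)
  have hch : ∀ i k, ∃ b ∈ F i, (L i).mkQ b = (β i k : M ⧸ L i) := fun i k => (β i k).2
  choose b hb hbβ using hch
  have hli : ∀ i, LinearIndependent ℤ fun k => (L i).mkQ (b i k) := by
    intro i
    have := (β i).linearIndependent.map' (Submodule.subtype _) (Submodule.ker_subtype _)
    simp only [hbβ]
    exact this
  let v : (Σ i, Module.Free.ChooseBasisIndex ℤ ((F i).map (L i).mkQ)) → M := fun p => b p.1 p.2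
  have hspan : ∀ i, F i ≤ Submodule.span ℤ (Set.range v) := by
    intro i
    induction i using WellFoundedLT.induction with
    | ind i ih =>
      have hL : L i ≤ Submodule.span ℤ (Set.range v) := iSup_le fun j => ih j.1 j.2
      intro x hx
      have hxs : (L i).mkQ x ∈ Submodule.span ℤ (Set.range fun k => (L i).mkQ (b i k)) := by
        have h1 := (β i).mem_span ⟨(L i).mkQ x, ⟨x, hx, rfl⟩⟩
        have h2 := Submodule.mem_map_of_mem (f := Submodule.subtype _) h1
        rw [Submodule.map_span, ← Set.range_comp] at h2
        simp only [hbβ]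
        exact h2
      rw [show (fun k => (L i).mkQ (b i k)) = (L i).mkQ ∘ b i from rfl, Set.range_comp,
        ← Submodule.map_span] at hxs
      obtain ⟨y, hy, hyx⟩ := hxs
      have hxy : x - y ∈ L i := by
        rw [← Submodule.Quotient.mk_eq_zero, Submodule.Quotient.mk_sub]
        exact sub_eq_zero.2 hyx.symm
      have hy' : y ∈ Submodule.span ℤ (Set.range v) := by
        refine Submodule.span_mono ?_ hy
        rintro _ ⟨k, rfl⟩
        exact ⟨⟨i, k⟩, rfl⟩
      simpa using Submodule.add_mem _ (hL hxy) hy'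
  have hind : LinearIndependent ℤ v := by
    rw [linearIndependent_iff]
    intro l hl
    by_contra hne
    have hsupp : l.splitSupport.Nonempty := by
      rw [Finset.nonempty_iff_ne_empty]
      intro h
      refine hne (Finsupp.ext fun ⟨i, k⟩ => ?_)
      rw [← Finsupp.split_apply]
      by_contra h'
      have : i ∈ l.splitSupport := by
        rw [Finsupp.mem_splitSupport_iff_nonzero]
        intro h0
        exact h' (by rw [h0]; rfl)
      rw [h] at this
      exact absurd this (Finset.notMem_empty i)
    set i := l.splitSupport.max' hsupp with hi
    have hmem : i ∈ l.splitSupport := Finset.max'_mem _ _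
    refine (Finsupp.mem_splitSupport_iff_nonzero _ _).1 hmem ?_
    refine linearIndependent_iff.1 (hli i) _ ?_
    have h1 := congrArg (L i).mkQ hl
    rw [Finsupp.linearCombination_apply, Finsupp.sigma_sum, map_zero, map_sum,
      Finset.sum_eq_single i] at h1
    · rw [Finsupp.linearCombination_apply, ← h1]
      simp only [Finsupp.sum, map_sum, map_smul, v]
    · intro j hj hji
      have hlt : j < i := lt_of_le_of_ne (Finset.le_max' _ _ hj) hji
      rw [Submodule.mkQ_apply, Submodule.Quotient.mk_eq_zero]
      refine Submodule.sum_mem _ fun k _ => Submodule.smul_mem _ _ ?_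
      exact Submodule.mem_iSup_of_mem (p := fun j : Set.Iio i => F j) ⟨j, hlt⟩ (hb j k)
    · exact fun h => absurd hmem h
  have heq : (⨆ i, F i) = Submodule.span ℤ (Set.range v) := by
    refine le_antisymm (iSup_le hspan) (Submodule.span_le.2 ?_)
    rintro _ ⟨⟨i, k⟩, rfl⟩
    exact Submodule.mem_iSup_of_mem i (hb i k)
  rw [heq]
  exact Module.Free.of_basis (Module.Basis.span hind)

/-- Finite-rank submodules are finitely generated if each nonzero one maps onto some nonzero
subgroup of `ℤ`. -/
theorem fg_of_rank_eq {M : Type u} [AddCommGroup M]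
    (hM : ∀ D : Submodule ℤ M, D ≠ ⊥ → Module.rank ℤ D < ℵ₀ → ¬ HomIntTrivial D) (n : ℕ)
    (D : Submodule ℤ M) (hD : Module.rank ℤ D = n) : D.FG := by
  induction n using Nat.strong_induction_on generalizing D with
  | _ n ih =>
    by_cases h0 : D = ⊥
    · rw [h0]
      exact Submodule.fg_bot
    have h1 := hM D h0 (by rw [hD]; exact natCast_lt_aleph0)
    simp only [HomIntTrivial, not_forall] at h1
    obtain ⟨φ, hφ⟩ := h1
    obtain ⟨x, hx⟩ := DFunLike.ne_iff.1 hφ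
    have hr := Submodule.rank_quotient_add_rank (LinearMap.ker φ)
    have hpos : Module.rank ℤ (D ⧸ LinearMap.ker φ) ≠ 0 := by
      intro h
      obtain ⟨a, ha, hax⟩ := rank_eq_zero_iff.1 h ((LinearMap.ker φ).mkQ x)
      rw [← map_smul, Submodule.mkQ_apply, Submodule.Quotient.mk_eq_zero, LinearMap.mem_ker,
        map_smul, smul_eq_mul] at hax
      exact (mul_eq_zero.1 hax).elim ha hx
    rw [hD] at hr
    obtain ⟨k, hk⟩ := lt_aleph0.1 ((hr ▸ le_add_self :
      Module.rank ℤ (LinearMap.ker φ) ≤ n).trans_lt natCast_lt_aleph0)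
    obtain ⟨l, hl⟩ := lt_aleph0.1 ((hr ▸ le_self_add :
      Module.rank ℤ (D ⧸ LinearMap.ker φ) ≤ n).trans_lt natCast_lt_aleph0)
    rw [hl, Nat.cast_ne_zero] at hpos
    rw [hk, hl, ← Nat.cast_add, Nat.cast_inj] at hr
    have hker : ((LinearMap.ker φ).map D.subtype).FG := by
      refine ih k (by omega) _ ?_
      rw [← hk]
      exact (Submodule.equivMapOfInjective D.subtype D.injective_subtype _).rank_eq.symm
    have hker' := Submodule.fg_of_fg_map_injective _ D.injective_subtype hker
    have htop : (⊤ : Submodule ℤ D).FG := by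
      refine Submodule.fg_of_fg_map_of_fg_inf_ker φ (IsNoetherian.noetherian _) ?_
      rwa [top_inf_eq]
    have := htop.map D.subtype
    rwa [Submodule.map_subtype_top] at this

/-- The elements with a nonzero multiple in `N`. -/
def torsionSaturation {M : Type*} [AddCommGroup M] (N : Submodule ℤ M) : Submodule ℤ M where
  carrier := {x | ∃ m : ℤ, m ≠ 0 ∧ m • x ∈ N}
  zero_mem' := ⟨1, one_ne_zero, by simp⟩
  add_mem' := by
    rintro x y ⟨m, hm, hx⟩ ⟨k, hk, hy⟩
    refine ⟨m * k, mul_ne_zero hm hk, ?_⟩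
    rw [smul_add, mul_smul, mul_smul, smul_comm m k x]
    exact N.add_mem (N.smul_mem _ hx) (N.smul_mem _ hy)
  smul_mem' := by
    rintro c x ⟨m, hm, hx⟩
    exact ⟨m, hm, by rw [smul_comm]; exact N.smul_mem _ hx⟩

theorem le_torsionSaturation {M : Type*} [AddCommGroup M] (N : Submodule ℤ M) :
    N ≤ torsionSaturation N := fun x hx => ⟨1, one_ne_zero, by rwa [one_smul]⟩

theorem mem_torsionSaturation_of_smul {M : Type*} [AddCommGroup M] {N : Submodule ℤ M} {m : ℤ}
    (hm : m ≠ 0) {x : M} (h : m • x ∈ torsionSaturation N) : x ∈ torsionSaturation N := by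
  obtain ⟨k, hk, hkx⟩ := h
  exact ⟨k * m, mul_ne_zero hk hm, by rwa [mul_smul]⟩

theorem torsionSaturation_mono {M : Type*} [AddCommGroup M] {N N' : Submodule ℤ M} (h : N ≤ N') :
    torsionSaturation N ≤ torsionSaturation N' := fun _ ⟨m, hm, hx⟩ => ⟨m, hm, h hx⟩

theorem rank_torsionSaturation {M : Type u} [AddCommGroup M] (N : Submodule ℤ M) :
    Module.rank ℤ (torsionSaturation N) = Module.rank ℤ N := by
  let S := torsionSaturation N
  have h := Submodule.rank_quotient_add_rank (N.comap S.subtype)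
  have h0 : Module.rank ℤ (S ⧸ N.comap S.subtype) = 0 := by
    rw [rank_eq_zero_iff]
    intro x
    obtain ⟨⟨x, m, hm, hx⟩, rfl⟩ := Submodule.mkQ_surjective _ x
    refine ⟨m, hm, ?_⟩
    rw [← map_smul, Submodule.mkQ_apply, Submodule.Quotient.mk_eq_zero]
    exact hx
  rw [h0, zero_add] at h
  rw [← h]
  exact (Submodule.comapSubtypeEquivOfLe (le_torsionSaturation N)).rank_eq

/-- A form of Pontryagin's criterion. -/
theorem free_of_countable {M : Type u} [AddCommGroup M] [Countable M] [Module.IsTorsionFree ℤ M]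
    (hM : ∀ D : Submodule ℤ M, D ≠ ⊥ → Module.rank ℤ D < ℵ₀ → ¬ HomIntTrivial D) :
    Module.Free ℤ M := by
  classical
  obtain ⟨g, hg⟩ := exists_surjective_nat M
  let N : ℕ → Submodule ℤ M := fun i => Submodule.span ℤ ((Finset.range i).image g : Finset M)
  let F : ℕ → Submodule ℤ M := fun i => torsionSaturation (N i)
  have hmono : Monotone F := fun i j hij => torsionSaturation_mono (Submodule.span_mono (by
    exact_mod_cast Finset.image_subset_image (Finset.range_mono hij)))
  have hFG : ∀ i, (F i).FG := by
    intro i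
    have h1 : Module.rank ℤ (F i) < ℵ₀ := by
      rw [rank_torsionSaturation]
      exact (rank_span_finset_le _).trans_lt natCast_lt_aleph0
    obtain ⟨k, hk⟩ := lt_aleph0.1 h1
    exact fg_of_rank_eq hM k _ hk
  have hfree : Module.Free ℤ (⨆ i, F i : Submodule ℤ M) := by
    refine free_iSup_of_free_quotients F fun i => ?_
    have hfin : Module.Finite ℤ ((F i).map (⨆ j : Set.Iio i, F j).mkQ) :=
      Module.Finite.iff_fg.2 ((hFG i).map _)
    have hL : ∃ N', (⨆ j : Set.Iio i, F j) = torsionSaturation N' ∨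
        (⨆ j : Set.Iio i, F j) = ⊥ := by
      cases i with
      | zero =>
        refine ⟨⊥, Or.inr ?_⟩
        have : IsEmpty (Set.Iio 0 : Set ℕ) := ⟨fun j => absurd j.2 (by simp)⟩
        exact iSup_of_empty _
      | succ i =>
        exact ⟨N i, Or.inl (le_antisymm (iSup_le fun j => hmono (Nat.lt_succ_iff.1 j.2))
          (le_iSup (fun j : Set.Iio (i + 1) => F j) ⟨i, Nat.lt_succ_self i⟩))⟩
    have htf : Module.IsTorsionFree ℤ (M ⧸ ⨆ j : Set.Iio i, F j) := by
      refine Module.IsTorsionFree.of_smul_eq_zero fun m x hmx => or_iff_not_imp_left.2 fun hm => ?_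
      obtain ⟨x, rfl⟩ := Submodule.mkQ_surjective _ x
      rw [← map_smul, Submodule.mkQ_apply, Submodule.Quotient.mk_eq_zero] at hmx
      rw [Submodule.mkQ_apply, Submodule.Quotient.mk_eq_zero]
      obtain ⟨N', h | h⟩ := hL
      · rw [h] at hmx ⊢
        exact mem_torsionSaturation_of_smul hm hmx
      · rw [h, Submodule.mem_bot] at hmx ⊢
        exact (smul_eq_zero.1 hmx).resolve_left hm
    have : Module.IsTorsionFree ℤ ((F i).map (⨆ j : Set.Iio i, F j).mkQ) := inferInstance
    exact Module.free_of_finite_type_torsion_free'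
  have htop : (⨆ i, F i) = ⊤ := by
    rw [eq_top_iff]
    rintro x -
    obtain ⟨i, rfl⟩ := hg x
    refine Submodule.mem_iSup_of_mem (i + 1) (le_torsionSaturation _ (Submodule.subset_span ?_))
    simp only [Finset.coe_image, Finset.coe_range]
    exact ⟨i, Set.mem_Iio.2 (Nat.lt_succ_self i), rfl⟩
  rw [htop] at hfree
  exact Module.Free.of_equiv Submodule.topEquiv

theorem not_homIntTrivial_of_isGood {B D : Type u} [AddCommGroup B] [AddCommGroup D]
    [Countable D] [Nontrivial D] {K : Submodule ℤ B} [Module.IsTorsionFree ℤ D]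
    (hgood : ∀ n, IsGood n K) (j : D →ₗ[ℤ] B ⧸ K) (hj : Function.Injective j)
    (hrank : Module.rank ℤ D < ℵ₀) : ¬ HomIntTrivial D := by
  intro htriv
  obtain ⟨s, hs, hmax⟩ := exists_maximal_linearIndepOn ℤ (id : D → D)
  have hsfin : Finite s :=
    lt_aleph0_iff_finite.1 ((LinearIndependent.cardinal_le_rank hs).trans_lt hrank)
  obtain ⟨n, ⟨e⟩⟩ := Finite.exists_equiv_fin s
  have hspan : ∀ d : D, ∃ m : ℤ, m ≠ 0 ∧ m • d ∈ Submodule.span ℤ s := by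
    intro d
    by_cases hd : d ∈ s
    · exact ⟨1, one_ne_zero, by rw [one_smul]; exact Submodule.subset_span hd⟩
    · obtain ⟨m, hm, h⟩ := hmax d hd
      exact ⟨m, hm, by simpa using h⟩
  obtain ⟨n, rfl⟩ : ∃ k, n = k + 1 := by
    refine Nat.exists_eq_succ_of_ne_zero ?_
    rintro rfl
    obtain ⟨d, hd⟩ := exists_ne (0 : D)
    obtain ⟨m, hm, h⟩ := hspan d
    have : s = ∅ := Set.eq_empty_of_forall_notMem fun a ha => (e ⟨a, ha⟩).elim0
    rw [this, Submodule.span_empty, Submodule.mem_bot] at h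
    exact (smul_eq_zero.1 h).elim hm hd
  let x : Fin (n + 1) → D := fun i => e.symm i
  have hx : LinearIndependent ℤ x := hs.comp _ e.symm.injective
  have hxs : Set.range x = s := by
    show Set.range (Subtype.val ∘ e.symm) = s
    rw [e.symm.surjective.range_comp, Subtype.range_coe]
  obtain ⟨g, hg⟩ := exists_surjective_nat D
  have hm : ∀ i, ∃ (m : ℤ) (a : Fin (n + 1) → ℤ), m ≠ 0 ∧ ∑ j, a j • x j = m • g i := by
    intro i
    obtain ⟨m, hm, h⟩ := hspan (g i)
    rw [← hxs, Submodule.mem_span_range_iff_exists_fun] at h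
    obtain ⟨a, ha⟩ := h
    exact ⟨m, a, hm, ha⟩
  choose m a hm ha using hm
  have hrigid : IsRigid m a := by
    refine ⟨hm, fun ζ hζ => ?_⟩
    obtain ⟨ψ, hψ⟩ := exists_rat_extension (Fintype.linearCombination ℤ x)
      (linearIndependent_iff_injective_fintypeLinearCombination.1 hx)
      (Fintype.linearCombination ℤ fun j => (ζ j : ℚ))
    have h1 : ∀ d, ((ψ d : ℚ) : AddCircle (1 : ℚ)) = 0 := by
      intro d
      obtain ⟨i, rfl⟩ := hg d
      obtain ⟨t, ht⟩ := hζ i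
      have h2 := hψ (a i)
      rw [Fintype.linearCombination_apply, ha, map_smul, Fintype.linearCombination_apply] at h2
      have h3 : (m i : ℚ) * ψ (g i) = m i * t := by
        simp only [zsmul_eq_mul] at h2
        rw [h2]
        exact_mod_cast ht
      rw [mul_left_cancel₀ (Int.cast_ne_zero.2 (hm i)) h3]
      exact (coe_circle_eq_zero_iff _).2 ⟨t, rfl⟩
    have h2 := htriv.eq_zero_of_coe ψ h1
    funext i
    have h3 := hψ (Pi.single i 1)
    rw [h2, Fintype.linearCombination_apply_single, one_smul] at h3
    exact_mod_cast h3.symm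
  choose X hX using fun i => K.mkQ_surjective (j (x i))
  choose Y hY using fun i => K.mkQ_surjective (j (g i))
  have hX0 := hgood n X m a (fun i => m i • Y i - ∑ j, a i j • X j) (fun i => by
    rw [← Submodule.Quotient.mk_eq_zero, ← Submodule.mkQ_apply, map_sub, map_sum, map_smul, hY,
      ← map_smul, ← ha, map_sum]
    simp only [map_smul, hX, sub_self]) hrigid fun i => ⟨Y i, by abel⟩
  rw [← Submodule.Quotient.mk_eq_zero, ← Submodule.mkQ_apply, hX, map_eq_zero_iff j hj] at hX0
  exact hx.ne_zero 0 hX0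

/-- A submodule closed under taking roots. -/
def IsPureSubmodule {B : Type*} [AddCommGroup B] (K : Submodule ℤ B) : Prop :=
  ∀ (m : ℤ) (b : B), m ≠ 0 → m • b ∈ K → b ∈ K

theorem free_map_mkQ {B : Type u} [AddCommGroup B] {K L F : Submodule ℤ B}
    (hpure : IsPureSubmodule K) (hgood : ∀ n, IsGood n K) [Countable F] (hLK : L ≤ K)
    (hFK : F ⊓ K ≤ L) : Module.Free ℤ (F.map L.mkQ) := by
  let j : F.map L.mkQ →ₗ[ℤ] B ⧸ K := (L.mapQ K LinearMap.id hLK).comp (Submodule.subtype _)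
  have hj : Function.Injective j := by
    rw [← LinearMap.ker_eq_bot, LinearMap.ker_eq_bot']
    rintro ⟨_, x, hx, rfl⟩ h
    have h1 : x ∈ K := (Submodule.Quotient.mk_eq_zero K).1 h
    exact Subtype.ext ((Submodule.Quotient.mk_eq_zero L).2 (hFK ⟨hx, h1⟩))
  have : Module.IsTorsionFree ℤ (B ⧸ K) := by
    refine Module.IsTorsionFree.of_smul_eq_zero fun m x hmx => or_iff_not_imp_left.2 fun hm => ?_
    obtain ⟨x, rfl⟩ := Submodule.mkQ_surjective _ x
    rw [← map_smul, Submodule.mkQ_apply, Submodule.Quotient.mk_eq_zero] at hmx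
    exact (Submodule.Quotient.mk_eq_zero K).2 (hpure m x hm hmx)
  have : Module.IsTorsionFree ℤ (F.map L.mkQ) := by
    refine Module.IsTorsionFree.of_smul_eq_zero fun m x hmx => or_iff_not_imp_left.2 fun hm => ?_
    have h1 := congrArg j hmx
    rw [map_smul, map_zero] at h1
    exact (map_eq_zero_iff j hj).1 ((smul_eq_zero.1 h1).resolve_left hm)
  have : Countable (F.map L.mkQ) := by
    refine Function.Surjective.countable (f := fun x : F => (⟨L.mkQ x, x, x.2, rfl⟩ :
      F.map L.mkQ)) ?_
    rintro ⟨_, x, hx, rfl⟩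
    exact ⟨⟨x, hx⟩, rfl⟩
  refine free_of_countable fun D hD hr => ?_
  have := Submodule.nontrivial_iff_ne_bot.2 hD
  exact not_homIntTrivial_of_isGood hgood (j.comp D.subtype)
    (hj.comp D.injective_subtype) hr

theorem LiftsCharacters.isGood_bot {B : Type*} [AddCommGroup B] (hB : LiftsCharacters B) (n : ℕ) :
    IsGood n (⊥ : Submodule ℤ B) := by
  intro x m a k hk hr hd
  have : x = 0 := hB.divRel_unique hr hd fun i => ⟨0, by simpa using (hk i).symm⟩
  rw [this]
  exact Submodule.zero_mem _

theorem LiftsCharacters.isPureSubmodule_bot {B : Type*} [AddCommGroup B] (hB : LiftsCharacters B) :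
    IsPureSubmodule (⊥ : Submodule ℤ B) := fun m b hm hb => by
  rw [Submodule.mem_bot] at hb ⊢
  exact hB.eq_zero_of_smul hm hb

theorem exists_listClosed_pure_good {B : Type u} [AddCommGroup B] (c : BorelCode B)
    (hB : LiftsCharacters B) :
    ∃ Φ : List B → Set B, (∀ l, (Φ l).Countable) ∧ ∀ s : Set B, ListClosed Φ s →
      ∃ K : Submodule ℤ B, (K : Set B) = s ∧ IsPureSubmodule K ∧ ∀ n, IsGood n K := by
  choose Φ hΦc hΦ using fun n => exists_listClosed_isGood c hB n
  let Ψ : List B → Set B := fun l => torsionSaturation (Submodule.span ℤ {b | b ∈ l})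
  have hΨ : ∀ l, (Ψ l).Countable := by
    intro l
    have h1 : Countable (Submodule.span ℤ {b | b ∈ l}) := countable_span l.finite_toSet.countable
    have h2 : Ψ l = ⋃ p : {m : ℤ // m ≠ 0} × Submodule.span ℤ {b | b ∈ l},
        {x : B | p.1.1 • x = p.2} := by
      ext x
      constructor
      · rintro ⟨m, hm, hx⟩
        exact Set.mem_iUnion.2 ⟨(⟨m, hm⟩, ⟨_, hx⟩), rfl⟩
      · intro h
        obtain ⟨⟨⟨m, hm⟩, y⟩, hx⟩ := Set.mem_iUnion.1 h
        exact ⟨m, hm, by rw [show m • x = y from hx]; exact y.2⟩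
    rw [h2]
    refine Set.countable_iUnion fun p => Set.Subsingleton.countable fun x hx y hy => ?_
    refine sub_eq_zero.1 (hB.eq_zero_of_smul p.1.2 ?_)
    rw [smul_sub, show p.1.1 • x = p.2 from hx, show p.1.1 • y = p.2 from hy, sub_self]
  refine ⟨fun l => Ψ l ∪ ⋃ n, Φ n l, fun l => (hΨ l).union (Set.countable_iUnion fun n => hΦc n l),
    fun s hs => ?_⟩
  have hs1 : ∀ l : List B, (∀ b ∈ l, b ∈ s) → ∀ x (m : ℤ), m ≠ 0 →
      m • x ∈ Submodule.span ℤ {b | b ∈ l} → x ∈ s := fun l hl x m hm hx =>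
    hs l hl (Or.inl ⟨m, hm, hx⟩)
  let K : Submodule ℤ B :=
    { carrier := s
      zero_mem' := hs1 [] (by simp) 0 1 one_ne_zero (by simp)
      add_mem' := fun {x y} hx hy => hs1 [x, y] (by simp [hx, hy]) (x + y) 1 one_ne_zero (by
        rw [one_smul]
        exact Submodule.add_mem _ (Submodule.subset_span (by simp))
          (Submodule.subset_span (by simp)))
      smul_mem' := fun m x hx => hs1 [x] (by simp [hx]) (m • x) 1 one_ne_zero (by
        rw [one_smul]
        exact Submodule.smul_mem _ _ (Submodule.subset_span (by simp))) }
  refine ⟨K, rfl, fun m b hm hb => hs1 [m • b] (fun y hy => (List.mem_singleton.1 hy) ▸ hb) b m hm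
    (Submodule.subset_span (by simp)), fun n => hΦ n K fun l hl => ?_⟩
  exact (Set.subset_iUnion (fun n => Φ n l) n).trans (Set.subset_union_right.trans (hs l hl))

theorem LiftsCharacters.aleph2Free {B : Type u} [AddCommGroup B] (c : BorelCode B)
    (hB : LiftsCharacters B) : Aleph2Free B := by
  intro G hG
  obtain ⟨Φ, hΦ, hgood⟩ := exists_listClosed_pure_good c hB
  let G' : Submodule ℤ B := AddSubgroup.toIntSubmodule G
  let ι := (aleph.{u} 1).ord.ToType
  obtain ⟨g, hg⟩ : ∃ g : ι → G, Function.Surjective g := by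
    have h : #G ≤ #ι := by rwa [Cardinal.mk_ord_toType]
    obtain ⟨e⟩ := h
    exact ⟨Function.invFun e, Function.invFun_surjective e.injective⟩
  let S : ι → Set B := fun i => listClosure Φ ((fun j => (g j : B)) '' Set.Iic i)
  have hSmono : Monotone S := fun i j hij =>
    listClosure_mono Φ (Set.image_mono (Set.Iic_subset_Iic.2 hij))
  have hSclosed : ∀ i, ListClosed Φ (S i) := fun i => listClosed_listClosure Φ _
  have hIic : ∀ i : ι, (Set.Iic i).Countable := fun i => by
    have h : (Set.Iio i).Countable := by
      have hlt : #(Set.Iio i) < aleph 1 := by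
        simpa [ι] using Cardinal.mk_Iio_lt i (by simp [ι])
      exact Cardinal.le_aleph0_iff_set_countable.1
        (Order.lt_succ_iff.1 (hlt.trans_eq Cardinal.succ_aleph0.symm))
    rw [← Set.Iio_insert]
    exact h.insert i
  have hScount : ∀ i, (S i).Countable := fun i =>
    countable_listClosure hΦ ((hIic i).image _)
  choose K hK _ _ using fun i => hgood (S i) (hSclosed i)
  have hmemK : ∀ i x, x ∈ K i ↔ x ∈ S i := fun i x => by rw [← SetLike.mem_coe, hK]
  let F : ι → Submodule ℤ B := fun i => G' ⊓ K i
  have hFtop : ⨆ i, F i = G' := by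
    refine le_antisymm (iSup_le fun i => inf_le_left) fun x hx => ?_
    obtain ⟨i, hi⟩ := hg ⟨x, hx⟩
    refine Submodule.mem_iSup_of_mem i ⟨hx, (hmemK i x).2 (subset_listClosure Φ _ ?_)⟩
    exact ⟨i, Set.self_mem_Iic, by simp [hi]⟩
  have hfree : Module.Free ℤ (⨆ i, F i : Submodule ℤ B) := by
    refine free_iSup_of_free_quotients F fun i => ?_
    have hcount : Countable (F i) :=
      ((hScount i).mono fun x hx => (hmemK i x).1 hx.2).to_subtype
    rcases isEmpty_or_nonempty (Set.Iio i) with hi | hi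
    · refine free_map_mkQ hB.isPureSubmodule_bot hB.isGood_bot (by simp) ?_
      exact inf_le_right.trans bot_le
    · obtain ⟨N, hN, hpure, hNgood⟩ := hgood (⋃ j : Set.Iio i, S j)
        (listClosed_iUnion (directed_of_isDirected_le fun _ _ h => hSmono h)
          fun j => hSclosed j)
      have hmemN : ∀ x, x ∈ N ↔ ∃ j : Set.Iio i, x ∈ S j := fun x => by
        rw [← SetLike.mem_coe, hN, Set.mem_iUnion]
      refine free_map_mkQ hpure hNgood
        (iSup_le fun j x hx => (hmemN x).2 ⟨j, (hmemK j x).1 hx.2⟩) fun x hx => ?_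
      obtain ⟨j, hj⟩ := (hmemN x).1 hx.2
      exact Submodule.mem_iSup_of_mem j ⟨hx.1.1, (hmemK j x).2 hj⟩
  rw [hFtop] at hfree
  exact hfree

/-- Every Borel Whitehead group is ℵ₂-free. -/
theorem borel_whitehead_aleph2Free (B : Type*) [AddCommGroup B]
    (hcode : HasBorelCode B) (hwh : IsWhitehead B) :
    Aleph2Free B := by
  obtain ⟨c⟩ := id hcode
  exact (IsWhitehead.liftsCharacters hcode hwh).aleph2Free c
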